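/- arXiv:2108.04411 — 3 statements merged into one kernel-verified Lean document; each statement's English description precedes it below -/
import Mathlib

section
/- If δ(𝐦) ≤ 0, then the anti-canonical height H_{(𝐚,𝐦)} fails to have the Northcott property: there exists a real number C such that infinitely many coprime pairs (x,y), taken up to simultaneous sign change, satisfy ℓ_i(x,y) ≠ 0 for all i and H_{(𝐚,𝐦)}(x,y) ≤ C. -/
open Finset

/-- `phiM m k` is the smallest positive integer `d` such that `k * d` is a perfect
`m`-th power. -/
noncomputable def phiM (m k : ℕ) : ℕ :=
  sInf {d : ℕ | 0 < d ∧ ∃ t : ℕ, k * d = t ^ m}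

/-- The linear form `ℓ(x,y) = α·y − β·x` attached to the point `[α : β]` of `ℙ¹`. -/
def ell (α β x y : ℤ) : ℤ := α * y - β * x

/-- The Euler characteristic `δ(𝐦) = 2 − ∑ᵢ (1 − 1/mᵢ)` of the stacky curve
`𝔛(ℙ¹ : (𝐚, 𝐦))`. -/
noncomputable def deltaM {n : ℕ} (m : Fin n → ℕ) : ℝ :=
  2 - ∑ i, (1 - (m i : ℝ)⁻¹)

/-- The height `H^δ_{(𝐚,𝐦)}(x,y) = ∏ᵢ φ_{mᵢ}(|ℓᵢ(x,y)|)^{1/mᵢ} · max(|x|,|y|)^δ`. -/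
noncomputable def stackyHeight {n : ℕ} (α β : Fin n → ℤ) (m : Fin n → ℕ) (δ : ℝ)
    (x y : ℤ) : ℝ :=
  (∏ i, (phiM (m i) ((ell (α i) (β i) x y).natAbs) : ℝ) ^ ((m i : ℝ)⁻¹)) *
    ((max |x| |y| : ℤ) : ℝ) ^ δ

/-- A height function `H` on the stacky curve has the Northcott property if for every
real `T` there are only finitely many coprime pairs `(x,y)` (finiteness of the set of
pairs is equivalent to finiteness up to simultaneous sign change) with `ℓᵢ(x,y) ≠ 0`
for all `i` and `H(x,y) ≤ T`. -/
def HasNorthcott {n : ℕ} (α β : Fin n → ℤ) (H : ℤ → ℤ → ℝ) : Prop :=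
  ∀ T : ℝ, {p : ℤ × ℤ | IsCoprime p.1 p.2 ∧ (∀ i, ell (α i) (β i) p.1 p.2 ≠ 0) ∧
    H p.1 p.2 ≤ T}.Finite

/-- All primes not dividing `B` occur in `k` with multiplicity divisible by `e`. -/
def IsPowAway (B e : ℕ) (k : ℤ) : Prop :=
  ∀ p : ℕ, p.Prime → ¬ p ∣ B → e ∣ k.natAbs.factorization p

lemma IsPowAway.mul {B e : ℕ} {k l : ℤ} (hk : IsPowAway B e k) (hl : IsPowAway B e l) :
    IsPowAway B e (k * l) := by
  intro p hp hB
  by_cases h : k * l = 0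
  · simp [h]
  · obtain ⟨hk0, hl0⟩ := mul_ne_zero_iff.1 h
    rw [Int.natAbs_mul, Nat.factorization_mul (by simpa) (by simpa), Finsupp.add_apply]
    exact dvd_add (hk p hp hB) (hl p hp hB)

lemma isPowAway_of_dvd {B e : ℕ} {k : ℤ} (h : k.natAbs ∣ B) : IsPowAway B e k := by
  intro p _ hB
  rw [Nat.factorization_eq_zero_of_not_dvd fun hpk => hB (hpk.trans h)]
  exact dvd_zero e

lemma isPowAway_pow (B e : ℕ) (z : ℤ) : IsPowAway B e (z ^ e) := by
  intro p _ _
  simp [Int.natAbs_pow]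

lemma isPowAway_one (B : ℕ) (k : ℤ) : IsPowAway B 1 k := fun _ _ _ => one_dvd _

lemma IsPowAway.mono {B B' e : ℕ} {k : ℤ} (h : IsPowAway B e k) (hB : B ∣ B') :
    IsPowAway B' e k := fun p hp hpB => h p hp fun h' => hpB (h'.trans hB)

/-- An integer that is an `e`-th power away from `B` becomes one after multiplication by a
divisor of `B ^ e`. -/
lemma IsPowAway.exists_mul_eq_pow {B e : ℕ} {k : ℤ} (h : IsPowAway B e k) (hB : B ≠ 0)
    (he : 0 < e) (hk : k ≠ 0) : ∃ c z : ℕ, c ∣ B ^ e ∧ c * k.natAbs = z ^ e := by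
  have hk' : k.natAbs ≠ 0 := by simpa
  set K := k.natAbs with hK
  set f := K.factorization with hf
  let g : ℕ → ℕ := fun p => (f p + (e - 1)) / e
  set z := ∏ p ∈ K.primeFactors, p ^ g p with hz
  have hz0 : z ≠ 0 := Finset.prod_ne_zero_iff.2 fun p hp =>
    pow_ne_zero _ (Nat.prime_of_mem_primeFactors hp).ne_zero
  have hg0 : ∀ p, f p = 0 → g p = 0 := by
    intro p hp
    simp only [g, hp, zero_add]
    exact Nat.div_eq_of_lt (by omega)
  have hfz : ∀ p, p.Prime → z.factorization p = g p := by
    intro p hp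
    rw [hz, Nat.factorization_prod fun q hq =>
      pow_ne_zero _ (Nat.prime_of_mem_primeFactors hq).ne_zero, Finset.sum_apply']
    rw [Finset.sum_congr rfl (g := fun q => if q = p then g p else 0)]
    · rw [Finset.sum_ite_eq']
      split_ifs with hmem
      · rfl
      · refine (hg0 p ?_).symm
        rwa [← Finsupp.notMem_support_iff]
    · intro q hq
      rw [(Nat.prime_of_mem_primeFactors hq).factorization_pow, Finsupp.single_apply]
      split_ifs with h'
      · rw [h']
      · rfl
  have hle : ∀ p, f p ≤ e * g p ∧ e * g p ≤ f p + e := by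
    intro p
    have h1 := Nat.div_add_mod (f p + (e - 1)) e
    have h2 := Nat.mod_lt (f p + (e - 1)) he
    constructor <;> simp only [g] <;> omega
  have hdvd : K ∣ z ^ e := by
    refine (Nat.factorization_prime_le_iff_dvd hk' (pow_ne_zero _ hz0)).1 fun p hp => ?_
    rw [Nat.factorization_pow, Finsupp.smul_apply, hfz p hp]
    exact (hle p).1
  obtain ⟨c, hc⟩ := hdvd
  have hc0 : c ≠ 0 := by
    rintro rfl
    exact pow_ne_zero e hz0 (by simpa using hc)
  refine ⟨c, z, ?_, by rw [hc, mul_comm]⟩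
  refine (Nat.factorization_prime_le_iff_dvd hc0 (pow_ne_zero _ hB)).1 fun p hp => ?_
  have hcp : e * g p = f p + c.factorization p := by
    have := congrArg (fun t => t.factorization p) hc
    simpa [Nat.factorization_pow, Nat.factorization_mul hk' hc0, hfz p hp] using this
  rw [Nat.factorization_pow, Finsupp.smul_apply, smul_eq_mul]
  by_cases hpB : p ∣ B
  · have h1 : 1 ≤ B.factorization p := hp.factorization_pos_of_dvd hB hpB
    have h2 : e * 1 ≤ e * B.factorization p := Nat.mul_le_mul_left _ h1
    have := (hle p).2
    omega
  · obtain ⟨t, ht⟩ := h p hp hpB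
    have hft : f p = e * t := ht
    have hgt : g p = t := by
      simp only [g, hft]
      rw [Nat.mul_add_div he, Nat.div_eq_of_lt (by omega), add_zero]
    rw [hgt] at hcp
    omega

lemma ell_ne_zero {a b x y : ℤ} (h : a * y ≠ x * b) : ell a b x y ≠ 0 := by
  rw [ell, mul_comm b]
  exact sub_ne_zero.2 h

lemma finite_isCoprime_ell_eq_zero {a b : ℤ} (hab : IsCoprime a b) :
    {p : ℤ × ℤ | IsCoprime p.1 p.2 ∧ ell a b p.1 p.2 = 0}.Finite := by
  refine Set.Finite.subset (((Set.toFinite {a, -a}).prod (Set.toFinite {b, -b}))) ?_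
  rintro ⟨x, y⟩ ⟨hxy, h0⟩
  simp only [ell] at hxy h0
  have h : a * y = b * x := by linarith
  refine Set.mk_mem_prod ?_ ?_
  · refine Int.natAbs_eq_natAbs_iff.1 (Int.natAbs_eq_of_dvd_dvd ?_ ?_)
    · exact hxy.dvd_of_dvd_mul_right ⟨b, by rw [h, mul_comm]⟩
    · exact hab.dvd_of_dvd_mul_left ⟨y, h.symm⟩
  · refine Int.natAbs_eq_natAbs_iff.1 (Int.natAbs_eq_of_dvd_dvd ?_ ?_)
    · exact hxy.symm.dvd_of_dvd_mul_right ⟨a, by rw [← h, mul_comm]⟩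
    · exact hab.symm.dvd_of_dvd_mul_left ⟨x, h⟩

/-- If the values of the forms at an integral multiple of a primitive vector are powers away from
`B`, with compatible exponents, then so are the values at the primitive vector itself. -/
lemma isPowAway_ell_of_mul {n : ℕ} {α β : Fin n → ℤ} {e : Fin n → ℕ} {B : ℕ}
    (hB : ∀ i j, i ≠ j → (ell (α i) (β i) (α j) (β j)).natAbs ∣ B)
    (hcomp : ∀ (i : Fin n) (t : ℕ), (∀ j, j ≠ i → e j ∣ t) → e i ∣ t)
    {x y g : ℤ} (hxy : IsCoprime x y) (hg : g ≠ 0)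
    (hne : ∀ r, ell (α r) (β r) x y ≠ 0)
    (hpow : ∀ r, IsPowAway B (e r) (g * ell (α r) (β r) x y)) (r : Fin n) :
    IsPowAway B (e r) (ell (α r) (β r) x y) := by
  intro p hp hpB
  have hsum : ∀ s, e s ∣ g.natAbs.factorization p +
      (ell (α s) (β s) x y).natAbs.factorization p := by
    intro s
    have := hpow s p hp hpB
    rwa [Int.natAbs_mul, Nat.factorization_mul (by simpa) (by simpa using hne s),
      Finsupp.add_apply] at this
  by_cases hr : p ∣ (ell (α r) (β r) x y).natAbs
  · refine (Nat.dvd_add_right (hcomp r _ fun j hj => ?_)).1 (hsum r)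
    have hpj : ¬ p ∣ (ell (α j) (β j) x y).natAbs := by
      intro hjd
      apply hpB
      refine dvd_trans ?_ (hB r j hj.symm)
      rw [← Int.natCast_dvd] at hr hjd ⊢
      have hx : (p : ℤ) ∣ ell (α r) (β r) (α j) (β j) * x := by
        have : ell (α r) (β r) (α j) (β j) * x =
          α j * ell (α r) (β r) x y - α r * ell (α j) (β j) x y := by simp only [ell]; ring
        rw [this]
        exact dvd_sub (hr.mul_left _) (hjd.mul_left _)
      have hy : (p : ℤ) ∣ ell (α r) (β r) (α j) (β j) * y := by
        have : ell (α r) (β r) (α j) (β j) * y =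
          β j * ell (α r) (β r) x y - β r * ell (α j) (β j) x y := by simp only [ell]; ring
        rw [this]
        exact dvd_sub (hr.mul_left _) (hjd.mul_left _)
      obtain ⟨u, v, huv⟩ := hxy
      have : ell (α r) (β r) (α j) (β j) = u * (ell (α r) (β r) (α j) (β j) * x) +
          v * (ell (α r) (β r) (α j) (β j) * y) := by
        linear_combination (- ell (α r) (β r) (α j) (β j)) * huv
      rw [this]
      exact dvd_add (hx.mul_left _) (hy.mul_left _)
    have := hsum j
    rwa [Nat.factorization_eq_zero_of_not_dvd hpj, add_zero] at this
  · rw [Nat.factorization_eq_zero_of_not_dvd hr]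
    exact dvd_zero _

/-- A supply of pairs `(U, V)`, with `U` odd and `V` highly divisible by `2`, on which the forms
through three chosen points specialise to powers away from `D` yields infinitely many
primitive vectors at which all forms are powers up to a bounded factor. -/
lemma infinite_isCoprime_pow {n : ℕ} {α β : Fin n → ℤ}
    (hprim : ∀ i, IsCoprime (α i) (β i))
    (hdist : ∀ i j, i ≠ j → α i * β j ≠ α j * β i) {e : Fin n → ℕ} (he : ∀ r, 0 < e r)
    (hcomp : ∀ (i : Fin n) (t : ℕ), (∀ j, j ≠ i → e j ∣ t) → e i ∣ t)
    {i j l : Fin n} (hij : i ≠ j) (hil : i ≠ l) (hjl : j ≠ l) {D : ℕ} (hD : D ≠ 0)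
    (hsupply : ∀ N : ℕ, ∃ U V : ℤ, Odd U ∧ V ≠ 0 ∧ 2 ^ N ∣ V ∧ IsPowAway D (e i) U ∧
      IsPowAway D (e j) V ∧ IsPowAway D (e l) (U + V) ∧
      ∀ r, r ≠ i → r ≠ j → r ≠ l → IsPowAway D (e r)
        (ell (α r) (β r) (α j) (β j) * ell (α i) (β i) (α l) (β l) * U +
          ell (α i) (β i) (α r) (β r) * ell (α l) (β l) (α j) (β j) * V)) :
    ∃ K : ℕ, {p : ℤ × ℤ | IsCoprime p.1 p.2 ∧ (∀ r, ell (α r) (β r) p.1 p.2 ≠ 0) ∧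
      ∀ r, ∃ c z : ℕ, 0 < c ∧ c ≤ K ∧
        c * (ell (α r) (β r) p.1 p.2).natAbs = z ^ e r}.Infinite := by
  let d : Fin n → Fin n → ℤ := fun r s => ell (α r) (β r) (α s) (β s)
  have hd : ∀ r s, r ≠ s → d r s ≠ 0 := fun r s hrs => ell_ne_zero (hdist r s hrs)
  let Δ : ℕ := ∏ q ∈ Finset.univ.filter (fun q : Fin n × Fin n => q.1 ≠ q.2), (d q.1 q.2).natAbs
  have hΔ0 : Δ ≠ 0 := Finset.prod_ne_zero_iff.2 fun q hq => by
    simpa using hd q.1 q.2 (Finset.mem_filter.1 hq).2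
  have hΔ : ∀ r s, r ≠ s → (d r s).natAbs ∣ Δ := fun r s hrs =>
    Finset.dvd_prod_of_mem (fun q : Fin n × Fin n => (d q.1 q.2).natAbs)
      (Finset.mem_filter.2 ⟨Finset.mem_univ (r, s), hrs⟩)
  let B := D * Δ
  have hB0 : B ≠ 0 := mul_ne_zero hD hΔ0
  have hB : ∀ r s, r ≠ s → (d r s).natAbs ∣ B := fun r s hrs => (hΔ r s hrs).mul_left D
  have hdB : ∀ {r s} (f : ℕ), r ≠ s → IsPowAway B f (d r s) :=
    fun f hrs => isPowAway_of_dvd (hB _ _ hrs)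
  refine ⟨B ^ ∑ r, e r, fun hfin => ?_⟩
  have hZ : (⋃ r, {p : ℤ × ℤ | IsCoprime p.1 p.2 ∧ ell (α r) (β r) p.1 p.2 = 0}).Finite :=
    Set.finite_iUnion fun r => finite_isCoprime_ell_eq_zero (hprim r)
  obtain ⟨M, hM⟩ := ((hfin.union hZ).image
    fun p : ℤ × ℤ => (d i l * ell (α j) (β j) p.1 p.2).natAbs).bddAbove
  obtain ⟨U, V, hU, hV0, hVN, hpU, hpV, hpW, hpr⟩ := hsupply M
  have hU0 : U ≠ 0 := by
    rintro rfl
    simp at hU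
  let X := α j * (d i l * U) - α i * (d l j * V)
  let Y := β j * (d i l * U) - β i * (d l j * V)
  have hi : ell (α i) (β i) X Y = d i j * d i l * U := by simp only [X, Y, d, ell]; ring
  have hj : ell (α j) (β j) X Y = d i j * d l j * V := by simp only [X, Y, d, ell]; ring
  have hl : ell (α l) (β l) X Y = d l j * d i l * (U + V) := by
    simp only [X, Y, d, ell]; ring
  have hr : ∀ r, ell (α r) (β r) X Y = d r j * d i l * U + d i r * d l j * V := by
    intro r
    simp only [X, Y, d, ell]; ring
  have hgcd : 0 < Int.gcd X Y := by
    rw [Nat.pos_iff_ne_zero, Ne, Int.gcd_eq_zero_iff]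
    rintro ⟨hX, hY⟩
    rw [hX, hY] at hi
    have : d i j * d i l * U = 0 := by rw [← hi]; simp [ell]
    exact mul_ne_zero (mul_ne_zero (hd _ _ hij) (hd _ _ hil)) hU0 this
  obtain ⟨x, y, hxy, hX, hY⟩ := Int.exists_gcd_one hgcd
  set g : ℤ := (Int.gcd X Y : ℤ) with hgdef
  have hg0 : g ≠ 0 := by rw [hgdef]; exact_mod_cast hgcd.ne'
  have hcop : IsCoprime x y := Int.isCoprime_iff_gcd_eq_one.2 hxy
  have hmul : ∀ r, g * ell (α r) (β r) x y = ell (α r) (β r) X Y := by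
    intro r
    rw [hX, hY]
    simp only [ell]; ring
  have hmem : (x, y) ∈ {p : ℤ × ℤ | IsCoprime p.1 p.2 ∧ (∀ r, ell (α r) (β r) p.1 p.2 ≠ 0) ∧
      ∀ r, ∃ c z : ℕ, 0 < c ∧ c ≤ B ^ ∑ r, e r ∧
        c * (ell (α r) (β r) p.1 p.2).natAbs = z ^ e r} ∪
      ⋃ r, {p : ℤ × ℤ | IsCoprime p.1 p.2 ∧ ell (α r) (β r) p.1 p.2 = 0} := by
    by_cases hne : ∀ r, ell (α r) (β r) x y ≠ 0
    · refine Or.inl ⟨hcop, hne, fun r => ?_⟩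
      have hpow : ∀ r, IsPowAway B (e r) (g * ell (α r) (β r) x y) := by
        intro r
        rw [hmul]
        have hDB : D ∣ B := Dvd.intro _ rfl
        by_cases hri : r = i
        · subst hri
          rw [hi]
          exact ((hdB _ hij).mul (hdB _ hil)).mul (hpU.mono hDB)
        by_cases hrj : r = j
        · subst hrj
          rw [hj]
          exact ((hdB _ hij).mul (hdB _ hjl.symm)).mul (hpV.mono hDB)
        by_cases hrl : r = l
        · subst hrl
          rw [hl]
          exact ((hdB _ hjl.symm).mul (hdB _ hil)).mul (hpW.mono hDB)
        rw [hr]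
        exact (hpr r hri hrj hrl).mono hDB
      obtain ⟨c, z, hc, hcz⟩ := (isPowAway_ell_of_mul hB hcomp hcop hg0 hne hpow
        r).exists_mul_eq_pow hB0 (he r) (hne r)
      refine ⟨c, z, Nat.pos_of_dvd_of_pos hc (by positivity), ?_, hcz⟩
      refine (Nat.le_of_dvd (by positivity) hc).trans ?_
      exact Nat.pow_le_pow_right (Nat.pos_of_ne_zero hB0)
        (Finset.single_le_sum (fun s _ => Nat.zero_le (e s)) (Finset.mem_univ r))
    · push Not at hne
      obtain ⟨r, hr0⟩ := hne
      exact Or.inr (Set.mem_iUnion.2 ⟨r, hcop, hr0⟩)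
  have hbound : (d i l * ell (α j) (β j) x y).natAbs ≤ M :=
    hM (Set.mem_image_of_mem (fun p : ℤ × ℤ => (d i l * ell (α j) (β j) p.1 p.2).natAbs) hmem)
  have hratio : U * (d i l * ell (α j) (β j) x y) = V * (d l j * ell (α i) (β i) x y) := by
    refine mul_left_cancel₀ hg0 ?_
    have h1 := hmul i
    have h2 := hmul j
    rw [hi] at h1
    rw [hj] at h2
    linear_combination (U * d i l) * h2 - (V * d l j) * h1
  have hjne : d i l * ell (α j) (β j) x y ≠ 0 := by
    refine mul_ne_zero (hd _ _ hil) fun h0 => ?_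
    have h2 := hmul j
    rw [hj, h0, mul_zero] at h2
    exact mul_ne_zero (mul_ne_zero (hd _ _ hij) (hd _ _ hjl.symm)) hV0 h2.symm
  have hdvd : (2 : ℤ) ^ M ∣ d i l * ell (α j) (β j) x y := by
    have hco : IsCoprime ((2 : ℤ) ^ M) U := (Int.isCoprime_two_left.2 hU).pow_left
    refine hco.dvd_of_dvd_mul_left ?_
    rw [hratio]
    exact hVN.mul_right _
  have h2M : 2 ^ M ≤ (d i l * ell (α j) (β j) x y).natAbs := by
    refine Nat.le_of_dvd (Int.natAbs_pos.2 hjne) ?_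
    have := Int.natAbs_dvd_natAbs.2 hdvd
    simpa [Int.natAbs_pow] using this
  exact absurd (h2M.trans hbound) (not_le.2 Nat.lt_two_pow_self)

/-- Iterates of tangent-doubling on `A³ + B³ = 43 C³`. -/
lemma exists_cube_add_cube (N : ℕ) : ∃ A B C : ℤ, Odd A ∧ Odd B ∧ C ≠ 0 ∧ 2 ^ (N + 1) ∣ C ∧
    A ^ 3 + B ^ 3 = 43 * C ^ 3 := by
  induction N with
  | zero => exact ⟨1, 7, 2, by decide, by decide, by norm_num, by norm_num, by norm_num⟩
  | succ N ih =>
    obtain ⟨A, B, C, hA, hB, hC, hN, h⟩ := ih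
    have hAB : A ^ 3 - B ^ 3 ≠ 0 := by
      intro h0
      have h8 : (8 : ℤ) ∣ C ^ 3 :=
        (pow_dvd_pow_of_dvd ((dvd_pow_self (2 : ℤ) N.succ_ne_zero).trans hN) 3)
      obtain ⟨s, hs⟩ := h8
      obtain ⟨t, ht⟩ := hA.pow (n := 3)
      omega
    refine ⟨A * (A ^ 3 + 2 * B ^ 3), -(B * (2 * A ^ 3 + B ^ 3)), C * (A ^ 3 - B ^ 3),
      ?_, ?_, mul_ne_zero hC hAB, ?_, ?_⟩
    · exact hA.mul (hA.pow.add_even (even_two_mul _))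
    · exact (hB.mul ((even_two_mul _).add_odd hB.pow)).neg
    · rw [pow_succ]
      exact mul_dvd_mul hN (hA.pow.sub_odd hB.pow).two_dvd
    · linear_combination (A ^ 3 - B ^ 3) ^ 3 * h

/-- Iterates of doubling on `z² = u⁴ + 3 w⁴`. -/
lemma exists_sq_eq_fourth_add_fourth (N : ℕ) : ∃ u w z : ℤ, Odd u ∧ w ≠ 0 ∧ 2 ^ (N + 1) ∣ w ∧
    u ^ 4 + 3 * w ^ 4 = z ^ 2 := by
  induction N with
  | zero => exact ⟨1, 2, 7, by decide, by norm_num, by norm_num, by norm_num⟩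
  | succ N ih =>
    obtain ⟨u, w, z, hu, hw, hN, h⟩ := ih
    have hw2 : Even w := even_iff_two_dvd.2 ((dvd_pow_self (2 : ℤ) N.succ_ne_zero).trans hN)
    have hw4 : Even (3 * w ^ 4) := (hw2.pow_of_ne_zero (by norm_num)).mul_left 3
    have hu0 : u ≠ 0 := by
      rintro rfl
      simp at hu
    have hz0 : z ≠ 0 := by
      rintro rfl
      have := hu.pow (n := 4) |>.add_even hw4
      rw [h] at this
      simp at this
    refine ⟨u ^ 4 - 3 * w ^ 4, 2 * (z * u) * w, z ^ 4 + 12 * (u * w) ^ 4, hu.pow.sub_even hw4,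
      mul_ne_zero (mul_ne_zero two_ne_zero (mul_ne_zero hz0 hu0)) hw, ?_, ?_⟩
    · rw [pow_succ']
      exact mul_dvd_mul (Dvd.intro _ rfl) hN
    · have h4 : z ^ 4 = (u ^ 4 + 3 * w ^ 4) ^ 2 := by rw [h]; ring
      have e1 : (2 * (z * u) * w) ^ 4 = 16 * (u ^ 4 + 3 * w ^ 4) ^ 2 * u ^ 4 * w ^ 4 := by
        rw [← h4]; ring
      rw [h4, e1]
      ring

/-- Iterates of doubling on `c² = a³ + 15 b⁶`. -/
lemma exists_sq_eq_cube_add_sixth (N : ℕ) : ∃ a b c : ℤ, Odd a ∧ b ≠ 0 ∧ 2 ^ (N + 1) ∣ b ∧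
    a ^ 3 + 15 * b ^ 6 = c ^ 2 := by
  induction N with
  | zero => exact ⟨1, 2, 31, by decide, by norm_num, by norm_num, by norm_num⟩
  | succ N ih =>
    obtain ⟨a, b, c, ha, hb, hN, h⟩ := ih
    have hb2 : Even b := even_iff_two_dvd.2 ((dvd_pow_self (2 : ℤ) N.succ_ne_zero).trans hN)
    have hb6 : Even (15 * b ^ 6) := (hb2.pow_of_ne_zero (by norm_num)).mul_left 15
    have hc0 : c ≠ 0 := by
      rintro rfl
      have := ha.pow (n := 3) |>.add_even hb6
      rw [h] at this
      simp at this
    refine ⟨a * (a ^ 3 - 8 * (15 * b ^ 6)), 2 * c * b,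
      a ^ 6 + 300 * a ^ 3 * b ^ 6 - 1800 * b ^ 12,
      ha.mul (ha.pow.sub_even (hb6.mul_left 8)), mul_ne_zero (mul_ne_zero two_ne_zero hc0) hb,
      ?_, ?_⟩
    · rw [pow_succ']
      exact mul_dvd_mul (Dvd.intro _ rfl) hN
    · have e1 : (2 * c * b) ^ 6 = 64 * (a ^ 3 + 15 * b ^ 6) ^ 3 * b ^ 6 := by
        rw [h]; ring
      rw [e1]
      ring

/-- Iterates of doubling on a quadratic twist of `y² = x (x - a) (x - b)`. -/
lemma exists_twist_points (a b : ℤ) (N : ℕ) : ∃ p q s t z v : ℤ, Odd p ∧ q ≠ 0 ∧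
    2 ^ (N + 1) ∣ q ∧ p = v ^ 2 ∧ q = 8 * (1 - 2 * a) * (1 - 2 * b) * z ^ 2 ∧
    p - a * q = s ^ 2 ∧ p - b * q = t ^ 2 := by
  have step : ∀ p q : ℤ, Odd p → Even q → q ≠ 0 →
      Odd ((p ^ 2 - a * b * q ^ 2) ^ 2) ∧ 4 * p * q * (p - a * q) * (p - b * q) ≠ 0 := by
    intro p q hp hq hq0
    have ne : ∀ {k : ℤ}, Odd k → k ≠ 0 := by
      rintro k hk rfl
      simp at hk
    refine ⟨(hp.pow.sub_even ((hq.pow_of_ne_zero two_ne_zero).mul_left _)).pow, ?_⟩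
    exact mul_ne_zero (mul_ne_zero (mul_ne_zero (mul_ne_zero (by norm_num) (ne hp)) hq0)
      (ne (hp.sub_even (hq.mul_left a)))) (ne (hp.sub_even (hq.mul_left b)))
  induction N with
  | zero =>
    have := step 1 2 (by decide) (by decide) (by norm_num)
    refine ⟨(1 ^ 2 - a * b * 2 ^ 2) ^ 2, 4 * 1 * 2 * (1 - a * 2) * (1 - b * 2),
      1 ^ 2 - 2 * a * 1 * 2 + a * b * 2 ^ 2, 1 ^ 2 - 2 * b * 1 * 2 + a * b * 2 ^ 2, 1,
      1 ^ 2 - a * b * 2 ^ 2, this.1, this.2, ⟨4 * (1 - a * 2) * (1 - b * 2), by ring⟩,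
      rfl, by ring, by ring, by ring⟩
  | succ N ih =>
    obtain ⟨p, q, s, t, z, v, hp, hq0, hN, hv, hz, hs, ht⟩ := ih
    have hq : Even q := even_iff_two_dvd.2 ((dvd_pow_self (2 : ℤ) N.succ_ne_zero).trans hN)
    have := step p q hp hq hq0
    refine ⟨(p ^ 2 - a * b * q ^ 2) ^ 2, 4 * p * q * (p - a * q) * (p - b * q),
      p ^ 2 - 2 * a * p * q + a * b * q ^ 2, p ^ 2 - 2 * b * p * q + a * b * q ^ 2,
      2 * v * z * s * t, p ^ 2 - a * b * q ^ 2, this.1, this.2, ?_, rfl, ?_, by ring, by ring⟩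
    · rw [pow_succ']
      have : 4 * p * q * (p - a * q) * (p - b * q) =
        2 * (2 * p * (p - a * q) * (p - b * q)) * q := by ring
      rw [this]
      exact mul_dvd_mul (Dvd.intro _ rfl) hN
    · rw [hs, ht]
      rw [show 4 * p * q * s ^ 2 * t ^ 2 = 4 * s ^ 2 * t ^ 2 * p * q by ring, hz, hv]
      ring

lemma phiM_rpow_le {m e k c z K : ℕ} {L X : ℝ} (hem : e ≤ m) (he : 0 < e) (hk : 0 < k)
    (hc : 0 < c) (hcK : c ≤ K) (hz : c * k = z ^ e) (hL : 1 ≤ L) (hX : 1 ≤ X)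
    (hkX : (k : ℝ) ≤ L * X) :
    (phiM m k : ℝ) ^ ((m : ℝ)⁻¹) ≤ K * (K * L) * X ^ ((e : ℝ)⁻¹ - (m : ℝ)⁻¹) := by
  have hz0 : 0 < z := by
    rcases Nat.eq_zero_or_pos z with rfl | h
    · rw [zero_pow he.ne'] at hz
      exact absurd hz (by positivity)
    · exact h
  have hφ : phiM m k ≤ c * z ^ (m - e) := by
    refine Nat.sInf_le ⟨by positivity, z, ?_⟩
    rw [← Nat.add_sub_cancel' hem, pow_add, ← hz, Nat.add_sub_cancel' hem]
    ring
  have he' : (0 : ℝ) < e := by exact_mod_cast he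
  have hem' : (e : ℝ) ≤ m := by exact_mod_cast hem
  have hm' : (0 : ℝ) < m := he'.trans_le hem'
  have hc1 : (1 : ℝ) ≤ c := by exact_mod_cast hc
  have hK1 : (1 : ℝ) ≤ K := by exact_mod_cast hc.trans_le hcK
  have hcK' : (c : ℝ) ≤ K := by exact_mod_cast hcK
  have hz' : (0 : ℝ) < z := by exact_mod_cast hz0
  have hm1 : ((m : ℝ)⁻¹) ≤ 1 := inv_le_one_of_one_le₀ (by exact_mod_cast he.trans_le hem)
  have he1 : ((e : ℝ)⁻¹) ≤ 1 := inv_le_one_of_one_le₀ (by exact_mod_cast he)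
  have hθ0 : 0 ≤ (e : ℝ)⁻¹ - (m : ℝ)⁻¹ := sub_nonneg.2 (inv_anti₀ he' hem')
  have hθ1 : (e : ℝ)⁻¹ - (m : ℝ)⁻¹ ≤ 1 := by
    have : 0 < (m : ℝ)⁻¹ := by positivity
    linarith
  have hzk : ((c : ℝ) * k) = (z : ℝ) ^ (e : ℝ) := by
    rw [Real.rpow_natCast]
    exact_mod_cast hz
  have hpow : ((z : ℝ) ^ (m - e)) ^ ((m : ℝ)⁻¹) =
      ((c : ℝ) * k) ^ ((e : ℝ)⁻¹ - (m : ℝ)⁻¹) := by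
    rw [hzk, ← Real.rpow_natCast, ← Real.rpow_mul hz'.le, ← Real.rpow_mul hz'.le,
      Nat.cast_sub hem]
    congr 1
    field_simp
  calc (phiM m k : ℝ) ^ ((m : ℝ)⁻¹)
      ≤ ((c : ℝ) * (z : ℝ) ^ (m - e)) ^ ((m : ℝ)⁻¹) := by
        refine Real.rpow_le_rpow (by positivity) ?_ (by positivity)
        exact_mod_cast hφ
    _ = (c : ℝ) ^ ((m : ℝ)⁻¹) * ((c : ℝ) * k) ^ ((e : ℝ)⁻¹ - (m : ℝ)⁻¹) := by
        rw [Real.mul_rpow (by positivity) (by positivity), hpow]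
    _ ≤ K * ((K * L) ^ ((e : ℝ)⁻¹ - (m : ℝ)⁻¹) * X ^ ((e : ℝ)⁻¹ - (m : ℝ)⁻¹)) := by
        rw [← Real.mul_rpow (by positivity) (by positivity)]
        refine mul_le_mul ?_ ?_ (by positivity) (by positivity)
        · exact (Real.rpow_le_self_of_one_le hc1 hm1).trans hcK'
        · refine Real.rpow_le_rpow (by positivity) ?_ hθ0
          rw [mul_assoc]
          exact mul_le_mul hcK' hkX (by positivity) (by positivity)
    _ ≤ K * (K * L) * X ^ ((e : ℝ)⁻¹ - (m : ℝ)⁻¹) := by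
        rw [mul_assoc]
        refine mul_le_mul_of_nonneg_left ?_ (by positivity)
        refine mul_le_mul_of_nonneg_right ?_ (by positivity)
        exact Real.rpow_le_self_of_one_le (one_le_mul_of_one_le_of_one_le hK1 hL) hθ1

lemma natAbs_ell_le (a b x y : ℤ) :
    ((ell a b x y).natAbs : ℝ) ≤ (|a| + |b| + 1 : ℤ) * ((max |x| |y| : ℤ) : ℝ) := by
  have h : |ell a b x y| ≤ (|a| + |b| + 1) * max |x| |y| := by
    have h1 : |a * y - b * x| ≤ |a| * |y| + |b| * |x| := by
      rw [← abs_mul, ← abs_mul]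
      exact abs_sub _ _
    have h2 : |a| * |y| ≤ |a| * max |x| |y| :=
      mul_le_mul_of_nonneg_left (le_max_right _ _) (abs_nonneg a)
    have h3 : |b| * |x| ≤ |b| * max |x| |y| :=
      mul_le_mul_of_nonneg_left (le_max_left _ _) (abs_nonneg b)
    have h4 : 0 ≤ max |x| |y| := (abs_nonneg x).trans (le_max_left _ _)
    simp only [ell]
    linarith
  rw [Nat.cast_natAbs]
  exact_mod_cast h

/-- If all forms are simultaneously powers, up to bounded factors, with exponents of total
Euler characteristic zero, then the anticanonical height is bounded. -/
lemma exists_infinite_stackyHeight_le {n : ℕ} {α β : Fin n → ℤ} {m e : Fin n → ℕ}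
    (he : ∀ r, 0 < e r) (hem : ∀ r, e r ≤ m r) (hsum : deltaM e = 0) {K : ℕ}
    (hinf : {p : ℤ × ℤ | IsCoprime p.1 p.2 ∧ (∀ r, ell (α r) (β r) p.1 p.2 ≠ 0) ∧
      ∀ r, ∃ c z : ℕ, 0 < c ∧ c ≤ K ∧
        c * (ell (α r) (β r) p.1 p.2).natAbs = z ^ e r}.Infinite) :
    ∃ C : ℝ, {p : ℤ × ℤ | IsCoprime p.1 p.2 ∧
        (∀ i, ell (α i) (β i) p.1 p.2 ≠ 0) ∧
        stackyHeight α β m (deltaM m) p.1 p.2 ≤ C}.Infinite := by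
  refine ⟨∏ r, ((K : ℝ) * (K * (|α r| + |β r| + 1 : ℤ))), hinf.mono ?_⟩
  rintro ⟨x, y⟩ ⟨hxy, hne, hpow⟩
  refine ⟨hxy, hne, ?_⟩
  dsimp only at hxy hne hpow ⊢
  have hX1 : (1 : ℤ) ≤ max |x| |y| := by
    by_contra! h
    have hx : |x| < 1 := (le_max_left _ _).trans_lt h
    have hy : |y| < 1 := (le_max_right _ _).trans_lt h
    rw [Int.abs_lt_one_iff] at hx hy
    subst hx hy
    exact not_isCoprime_zero_zero hxy
  rw [stackyHeight]
  set X : ℝ := ((max |x| |y| : ℤ) : ℝ) with hXdef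
  have hX : 1 ≤ X := by rw [hXdef]; exact_mod_cast hX1
  have hX0 : 0 < X := by linarith
  have hexp : ∑ r, ((e r : ℝ)⁻¹ - (m r : ℝ)⁻¹) = - deltaM m := by
    simp only [deltaM, Finset.sum_sub_distrib] at hsum ⊢
    linarith
  have hprod : ∏ r, (phiM (m r) ((ell (α r) (β r) x y).natAbs) : ℝ) ^ ((m r : ℝ)⁻¹) ≤
      (∏ r, ((K : ℝ) * (K * (|α r| + |β r| + 1 : ℤ)))) * X ^ (- deltaM m) := by
    rw [← hexp, Real.rpow_sum_of_pos hX0, ← Finset.prod_mul_distrib]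
    refine Finset.prod_le_prod (fun r _ => by positivity) fun r _ => ?_
    obtain ⟨c, z, hc, hcK, hz⟩ := hpow r
    refine phiM_rpow_le (hem r) (he r) (Int.natAbs_pos.2 (hne r)) hc hcK hz ?_ hX
      (natAbs_ell_le _ _ _ _)
    have : (1 : ℤ) ≤ |α r| + |β r| + 1 := by
      have := abs_nonneg (α r)
      have := abs_nonneg (β r)
      linarith
    exact_mod_cast this
  calc _ ≤ ((∏ r, ((K : ℝ) * (K * (|α r| + |β r| + 1 : ℤ)))) * X ^ (- deltaM m)) *
        X ^ deltaM m := mul_le_mul_of_nonneg_right hprod (by positivity)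
    _ = _ := by
      rw [mul_assoc, ← Real.rpow_add hX0]
      simp

/-- The case of three points, with exponents forming a Euclidean triangle signature. -/
lemma infinite_of_three {α β : Fin 3 → ℤ} (hprim : ∀ i, IsCoprime (α i) (β i))
    (hdist : ∀ i j, i ≠ j → α i * β j ≠ α j * β i) {m : Fin 3 → ℕ} (σ : Equiv.Perm (Fin 3))
    {e : Fin 3 → ℕ} (he : ∀ r, 0 < e r) (hem : ∀ r, e r ≤ m (σ r)) (hsum : deltaM e = 0)
    (hcomp : ∀ (i : Fin 3) (t : ℕ), (∀ j, j ≠ i → e j ∣ t) → e i ∣ t) {D : ℕ} (hD : D ≠ 0)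
    (hsupply : ∀ N : ℕ, ∃ U V : ℤ, Odd U ∧ V ≠ 0 ∧ 2 ^ N ∣ V ∧ IsPowAway D (e 1) U ∧
      IsPowAway D (e 2) V ∧ IsPowAway D (e 0) (U + V)) :
    ∃ C : ℝ, {p : ℤ × ℤ | IsCoprime p.1 p.2 ∧
        (∀ i, ell (α i) (β i) p.1 p.2 ≠ 0) ∧
        stackyHeight α β m (deltaM m) p.1 p.2 ≤ C}.Infinite := by
  have hσ : ∀ {a b : Fin 3}, a ≠ b → σ a ≠ σ b := fun h h' => h (σ.injective h')
  obtain ⟨K, hK⟩ := infinite_isCoprime_pow hprim hdist (e := e ∘ σ.symm) (fun r => he _)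
    (fun i t h => hcomp _ t fun j hj => by
      simpa using h (σ j) fun h' => hj (by simp [← h']))
    (i := σ 1) (j := σ 2) (l := σ 0) (hσ (by decide)) (hσ (by decide)) (hσ (by decide)) hD
    (fun N => by
      obtain ⟨U, V, hU, hV, hN, h1, h2, h0⟩ := hsupply N
      refine ⟨U, V, hU, hV, hN, by simpa using h1, by simpa using h2, by simpa using h0, ?_⟩
      intro r hr1 hr2 hr0
      obtain ⟨s, rfl⟩ := σ.surjective r
      fin_cases s
      · exact absurd rfl hr0
      · exact absurd rfl hr1
      · exact absurd rfl hr2)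
  refine exists_infinite_stackyHeight_le (fun r => he _) (fun r => ?_) ?_ hK
  · simpa using hem (σ.symm r)
  · rw [← hsum]
    simp only [deltaM]
    rw [← Equiv.sum_comp σ.symm fun r => 1 - (e r : ℝ)⁻¹]

/-- The case of at least four points. -/
lemma infinite_of_four {k : ℕ} {α β : Fin (4 + k) → ℤ} (hprim : ∀ i, IsCoprime (α i) (β i))
    (hdist : ∀ i j, i ≠ j → α i * β j ≠ α j * β i) {m : Fin (4 + k) → ℕ} (hm : ∀ i, 2 ≤ m i) :
    ∃ C : ℝ, {p : ℤ × ℤ | IsCoprime p.1 p.2 ∧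
        (∀ i, ell (α i) (β i) p.1 p.2 ≠ 0) ∧
        stackyHeight α β m (deltaM m) p.1 p.2 ≤ C}.Infinite := by
  let e : Fin (4 + k) → ℕ := fun r => if r.val < 4 then 2 else 1
  obtain ⟨i₀, v0⟩ : ∃ i : Fin (4 + k), i.val = 0 := ⟨⟨0, by omega⟩, rfl⟩
  obtain ⟨i₁, v1⟩ : ∃ i : Fin (4 + k), i.val = 1 := ⟨⟨1, by omega⟩, rfl⟩
  obtain ⟨i₂, v2⟩ : ∃ i : Fin (4 + k), i.val = 2 := ⟨⟨2, by omega⟩, rfl⟩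
  obtain ⟨i₃, v3⟩ : ∃ i : Fin (4 + k), i.val = 3 := ⟨⟨3, by omega⟩, rfl⟩
  have n01 : i₀ ≠ i₁ := by rw [Ne, Fin.ext_iff]; omega
  have n02 : i₀ ≠ i₂ := by rw [Ne, Fin.ext_iff]; omega
  have n12 : i₁ ≠ i₂ := by rw [Ne, Fin.ext_iff]; omega
  have n13 : i₁ ≠ i₃ := by rw [Ne, Fin.ext_iff]; omega
  have hd : ∀ r s, r ≠ s → ell (α r) (β r) (α s) (β s) ≠ 0 :=
    fun r s hrs => ell_ne_zero (hdist r s hrs)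
  set a := ell (α i₃) (β i₃) (α i₁) (β i₁) * ell (α i₀) (β i₀) (α i₂) (β i₂) with ha
  set b := ell (α i₀) (β i₀) (α i₃) (β i₃) * ell (α i₂) (β i₂) (α i₁) (β i₁) with hb
  have ha0 : a ≠ 0 := mul_ne_zero (hd _ _ n13.symm) (hd _ _ n02)
  set D₀ : ℤ := 8 * (1 - 2 * a) * (1 - 2 * b) with hD₀
  have hD₀0 : D₀ ≠ 0 := mul_ne_zero (mul_ne_zero (by norm_num) (by omega)) (by omega)
  have hD : (a * D₀).natAbs ≠ 0 := by simpa using ⟨ha0, hD₀0⟩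
  have hpa : ∀ f, IsPowAway (a * D₀).natAbs f a := fun f =>
    isPowAway_of_dvd (Int.natAbs_dvd_natAbs.2 (Dvd.intro _ rfl))
  obtain ⟨K, hK⟩ := infinite_isCoprime_pow hprim hdist (e := e)
    (fun r => by simp only [e]; split_ifs <;> norm_num)
    (fun i t h => by
      have h2 : 2 ∣ t := by
        by_cases hi : i = i₀
        · simpa [e, v1] using h i₁ (by rw [hi]; exact n01.symm)
        · simpa [e, v0] using h i₀ (Ne.symm hi)
      simp only [e]
      split_ifs
      · exact h2
      · exact one_dvd t) n01 n02 n12 hD (fun N => by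
      obtain ⟨p, q, s, t, z, v, hp, hq0, hN, hv, hz, hs, ht⟩ := exists_twist_points a b N
      refine ⟨p, -(a * q), hp, neg_ne_zero.2 (mul_ne_zero ha0 hq0), ?_, ?_, ?_, ?_, ?_⟩
      · exact (((pow_dvd_pow 2 N.le_succ).trans hN).mul_left a).neg_right
      · have : e i₀ = 2 := by simp [e, v0]
        rw [this, hv]
        exact isPowAway_pow _ _ _
      · have : e i₁ = 2 := by simp [e, v1]
        rw [this, hz, ← hD₀, show -(a * (D₀ * z ^ 2)) = -(a * D₀) * z ^ 2 by ring]
        refine IsPowAway.mul (isPowAway_of_dvd ?_) (isPowAway_pow _ _ _)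
        rw [Int.natAbs_neg]
      · have : e i₂ = 2 := by simp [e, v2]
        rw [this, ← sub_eq_add_neg, hs]
        exact isPowAway_pow _ _ _
      · intro r hr0 hr1 hr2
        by_cases hr3 : r = i₃
        · have : e i₃ = 2 := by simp [e, v3]
          rw [hr3, this, ← ha, ← hb,
            show a * p + b * -(a * q) = a * (p - b * q) by ring, ht]
          exact (hpa 2).mul (isPowAway_pow _ _ _)
        · have : e r = 1 := by
            rw [Ne, Fin.ext_iff] at hr0 hr1 hr2
            rw [Fin.ext_iff] at hr3
            simp only [e]
            rw [if_neg (by omega)]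
          rw [this]
          exact isPowAway_one _ _)
  refine exists_infinite_stackyHeight_le (fun r => ?_) (fun r => ?_) ?_ hK
  · simp only [e]; split_ifs <;> norm_num
  · have := hm r
    simp only [e]; split_ifs <;> omega
  · simp only [deltaM, e]
    rw [Fin.sum_univ_add]
    simp
    norm_num

/-- If `δ(𝐦) ≤ 0` then the anticanonical height `H_{(𝐚,𝐦)} = H^{δ(𝐦)}_{(𝐚,𝐦)}`
fails the Northcott property: some bound `C` admits infinitely many coprime pairs
(of height at most `C`, with all `ℓᵢ(x,y) ≠ 0`). -/
theorem anticanonical_northcott_fails_of_nonpos_chi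
    (n : ℕ) (hn : 1 ≤ n) (α β : Fin n → ℤ)
    (hprim : ∀ i, IsCoprime (α i) (β i))
    (hdist : ∀ i j, i ≠ j → α i * β j ≠ α j * β i)
    (m : Fin n → ℕ) (hm : ∀ i, 2 ≤ m i)
    (hδ : deltaM m ≤ 0) :
    ∃ C : ℝ, {p : ℤ × ℤ | IsCoprime p.1 p.2 ∧
        (∀ i, ell (α i) (β i) p.1 p.2 ≠ 0) ∧
        stackyHeight α β m (deltaM m) p.1 p.2 ≤ C}.Infinite := by
  have hpos : ∀ i, (0 : ℝ) < (m i : ℝ)⁻¹ := fun i => by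
    have : (0 : ℝ) < m i := by exact_mod_cast zero_lt_two.trans_le (hm i)
    positivity
  rcases Nat.lt_or_ge n 4 with h4 | h4
  · interval_cases n
    · have := hpos 0
      simp only [deltaM, Fin.sum_univ_one] at hδ
      linarith
    · have := hpos 0
      have := hpos 1
      simp only [deltaM, Fin.sum_univ_two] at hδ
      linarith
    · let σ := Tuple.sort m
      have hmono : Monotone (m ∘ σ) := Tuple.monotone_sort m
      have h01 : m (σ 0) ≤ m (σ 1) := hmono (by decide)
      have h12 : m (σ 1) ≤ m (σ 2) := hmono (by decide)
      have hs : (m (σ 0) : ℝ)⁻¹ + (m (σ 1) : ℝ)⁻¹ + (m (σ 2) : ℝ)⁻¹ ≤ 1 := by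
        have : deltaM (m ∘ σ) = deltaM m := by
          simp only [deltaM, Function.comp_apply]
          rw [Equiv.sum_comp σ fun r => 1 - (m r : ℝ)⁻¹]
        rw [← this] at hδ
        simp only [deltaM, Fin.sum_univ_three, Function.comp_apply] at hδ
        linarith
      have hp2 := hpos (σ 2)
      have ha2 := hm (σ 0)
      generalize hga : m (σ 0) = a at *
      generalize hgb : m (σ 1) = b at *
      generalize hgc : m (σ 2) = c at *
      rcases Nat.lt_or_ge a 3 with ha | ha
      · obtain rfl : a = 2 := by omega
        rcases Nat.lt_or_ge b 4 with hb | hb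
        · obtain rfl : b = 3 := by
            by_contra hb3
            obtain rfl : b = 2 := by omega
            norm_num at hs
            linarith
          have hc : 6 ≤ c := by
            by_contra! hc
            interval_cases c <;> norm_num at hs
          refine infinite_of_three hprim hdist σ (e := ![2, 3, 6]) (D := 15) ?_ ?_ ?_ ?_
            (by norm_num) ?_
          · decide
          · intro r
            fin_cases r
            · exact hga.ge
            · exact hgb.ge
            · exact hc.trans hgc.ge
          · simp [deltaM, Fin.sum_univ_three]
            norm_num
          · intro i t h
            fin_cases i
            · have : 6 ∣ t := h 2 (by decide)
              exact dvd_trans (by norm_num) this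
            · have : 6 ∣ t := h 2 (by decide)
              exact dvd_trans (by norm_num) this
            · have h2 : 2 ∣ t := h 0 (by decide)
              have h3 : 3 ∣ t := h 1 (by decide)
              change 6 ∣ t
              omega
          · intro N
            obtain ⟨a, b, c, ha, hb, hN, h⟩ := exists_sq_eq_cube_add_sixth N
            refine ⟨a ^ 3, 15 * b ^ 6, ha.pow, mul_ne_zero (by norm_num) (pow_ne_zero _ hb),
              ?_, isPowAway_pow _ 3 _, ?_, ?_⟩
            · exact ((((pow_dvd_pow 2 N.le_succ).trans hN).trans
                (dvd_pow_self b (by norm_num))).mul_left 15)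
            · exact IsPowAway.mul (isPowAway_of_dvd (by norm_num)) (isPowAway_pow _ 6 _)
            · rw [h]
              exact isPowAway_pow _ 2 _
        · refine infinite_of_three hprim hdist σ (e := ![2, 4, 4]) (D := 3) ?_ ?_ ?_ ?_
            (by norm_num) ?_
          · decide
          · intro r
            fin_cases r
            · exact hga.ge
            · exact hb.trans hgb.ge
            · exact (hb.trans h12).trans hgc.ge
          · simp [deltaM, Fin.sum_univ_three]
            norm_num
          · intro i t h
            fin_cases i
            · have : 4 ∣ t := h 2 (by decide)
              exact dvd_trans (by norm_num) this
            · exact h 2 (by decide)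
            · exact h 1 (by decide)
          · intro N
            obtain ⟨u, w, z, hu, hw, hN, h⟩ := exists_sq_eq_fourth_add_fourth N
            refine ⟨u ^ 4, 3 * w ^ 4, hu.pow, mul_ne_zero (by norm_num) (pow_ne_zero _ hw),
              ?_, isPowAway_pow _ 4 _, ?_, ?_⟩
            · exact ((((pow_dvd_pow 2 N.le_succ).trans hN).trans
                (dvd_pow_self w (by norm_num))).mul_left 3)
            · exact IsPowAway.mul (isPowAway_of_dvd (by norm_num)) (isPowAway_pow _ 4 _)
            · rw [h]
              exact isPowAway_pow _ 2 _
      · refine infinite_of_three hprim hdist σ (e := ![3, 3, 3]) (D := 43) ?_ ?_ ?_ ?_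
          (by norm_num) ?_
        · decide
        · intro r
          fin_cases r
          · exact ha.trans hga.ge
          · exact (ha.trans h01).trans hgb.ge
          · exact ((ha.trans h01).trans h12).trans hgc.ge
        · simp [deltaM, Fin.sum_univ_three]
          norm_num
        · intro i t h
          fin_cases i
          · exact h 1 (by decide)
          · exact h 2 (by decide)
          · exact h 1 (by decide)
        · intro N
          obtain ⟨A, B, C, hA, hB, hC, hN, h⟩ := exists_cube_add_cube N
          refine ⟨A ^ 3, -43 * C ^ 3, hA.pow, mul_ne_zero (by norm_num) (pow_ne_zero _ hC),
            ?_, isPowAway_pow _ 3 _, ?_, ?_⟩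
          · exact ((((pow_dvd_pow 2 N.le_succ).trans hN).trans
              (dvd_pow_self C (by norm_num))).mul_left _)
          · exact IsPowAway.mul (isPowAway_of_dvd (by norm_num)) (isPowAway_pow _ 3 _)
          · rw [show A ^ 3 + -43 * C ^ 3 = (-B) ^ 3 by linear_combination h]
            exact isPowAway_pow _ 3 _
  · obtain ⟨k, rfl⟩ := Nat.exists_eq_add_of_le h4
    exact infinite_of_four hprim hdist hm
end

section
/- Assume the abc-conjecture. Then for every real number δ > δ(𝐦), the function H^δ_{(𝐚,𝐦)} has the Northcott property. -/
open Finset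

/-- The radical of a positive integer: the product of its distinct prime factors. -/
def radN (k : ℕ) : ℕ := ∏ p ∈ k.primeFactors, p

/-- The `abc`-conjecture: for every `ε > 0` there is `C_ε > 0` such that all coprime
positive integers `a, b, c` with `a + b = c` satisfy `c ≤ C_ε · rad(abc)^{1+ε}`. -/
def ABCConjecture : Prop :=
  ∀ ε : ℝ, 0 < ε → ∃ C : ℝ, 0 < C ∧
    ∀ a b c : ℕ, 0 < a → 0 < b → 0 < c → Nat.Coprime a b → a + b = c →
      (c : ℝ) ≤ C * (radN (a * b * c) : ℝ) ^ (1 + ε)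

open Polynomial in
theorem exists_int_combination_X_pow_dvd {n : ℕ} (hn : 2 ≤ n) (w : Fin n → ℤ[X]) :
    ∃ r : Fin n → ℤ, r ≠ 0 ∧ ∑ i, r i = 0 ∧ X ^ (n - 2) ∣ ∑ i, C (r i) * w i := by
  classical
  let A : Matrix (Fin n) (Fin n) ℤ := fun k i =>
    if (k : ℕ) < n - 2 then (w i).coeff k else if (k : ℕ) = n - 2 then 1 else 0
  have hdet : A.det = 0 := by
    refine Matrix.det_eq_zero_of_row_eq_zero (⟨n - 1, by omega⟩ : Fin n) fun j => ?_
    have h₁ : ¬ (n - 1 < n - 2) := by omega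
    have h₂ : ¬ (n - 1 = n - 2) := by omega
    simp [A, h₁, h₂]
  obtain ⟨r, hr, hAr⟩ := Matrix.exists_mulVec_eq_zero_iff.mpr hdet
  refine ⟨r, hr, ?_, ?_⟩
  · have := congrFun hAr ⟨n - 2, by omega⟩
    simpa [A, Matrix.mulVec, dotProduct] using this
  · rw [X_pow_dvd_iff]
    intro d hd
    have := congrFun hAr ⟨d, by omega⟩
    simpa [A, Matrix.mulVec, dotProduct, hd, finsetSum_coeff, mul_comm] using this

open Polynomial in
theorem derivative_prod_pow_mul_prod {ι R : Type*} [Fintype ι] [DecidableEq ι] [CommRing R]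
    (u : ι → R[X]) (p : ι → ℕ) :
    derivative (∏ i, u i ^ p i) * ∏ i, u i =
      (∏ i, u i ^ p i) *
        ∑ i, C (p i : R) * (derivative (u i) * ∏ j ∈ univ.erase i, u j) := by
  rw [derivative_prod_finset, sum_mul, mul_sum]
  refine sum_congr rfl fun i _ => ?_
  rw [← mul_prod_erase univ u (mem_univ i), ← mul_prod_erase univ (fun i => u i ^ p i) (mem_univ i),
    derivative_pow]
  rcases Nat.eq_zero_or_pos (p i) with h | h
  · simp [h]
  · obtain ⟨k, hk⟩ := Nat.exists_eq_succ_of_ne_zero h.ne'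
    rw [hk]
    simp only [Nat.succ_eq_add_one, Nat.add_sub_cancel]
    ring

open Polynomial in
theorem X_pow_succ_dvd_of_dvd_wronskian {R : Type*} [CommRing R] [IsDomain R] [CharZero R]
    {e Q : R[X]} (he : e.coeff 0 = 0) (hQ : Q.coeff 0 ≠ 0) (N : ℕ)
    (h : X ^ N ∣ derivative e * Q - e * derivative Q) : X ^ (N + 1) ∣ e := by
  have key : ∀ k, k ≤ N → X ^ (k + 1) ∣ e := by
    intro k
    induction k with
    | zero => intro _; simpa [X_dvd_iff] using he
    | succ k ih =>
      intro hk
      obtain ⟨G, rfl⟩ := ih (by omega)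
      have h₁ : X ^ (k + 1) ∣ derivative (X ^ (k + 1) * G) * Q - X ^ (k + 1) * G * derivative Q :=
        (pow_dvd_pow X hk).trans h
      have h₂ : derivative (X ^ (k + 1) * G) * Q - X ^ (k + 1) * G * derivative Q =
          X ^ (k + 1) * (derivative G * Q - G * derivative Q)
            + X ^ k * (C ((k + 1 : ℕ) : R) * G * Q) := by
        rw [derivative_mul, derivative_X_pow]
        simp only [Nat.add_sub_cancel]
        ring
      rw [h₂, dvd_add_right (dvd_mul_right _ _), pow_succ,
        mul_dvd_mul_iff_left (pow_ne_zero _ X_ne_zero), X_dvd_iff] at h₁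
      have h₃ : G.coeff 0 = 0 := by
        rw [mul_coeff_zero, mul_coeff_zero, coeff_C_zero] at h₁
        have : ((k + 1 : ℕ) : R) ≠ 0 := Nat.cast_ne_zero.mpr (by omega)
        simpa [this, hQ, -Nat.cast_add] using h₁
      obtain ⟨G', rfl⟩ := X_dvd_iff.mpr h₃
      exact ⟨G', by ring⟩
  exact key N le_rfl

open Polynomial in
/-- An explicit Belyi map with prescribed zeros and poles at the zeros of the linear forms
`α i * X - β i`, highly ramified at the point `0`. -/
theorem exists_belyi_exponents {n : ℕ} (hn : 2 ≤ n) (α β : Fin n → ℤ) (hβ : ∀ i, β i ≠ 0) :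
    ∃ p q : Fin n → ℕ, (∀ i, p i = 0 ∨ q i = 0) ∧ ∑ i, p i = ∑ i, q i ∧ 0 < ∑ i, p i ∧
      ∃ a b : ℤ, a ≠ 0 ∧ b ≠ 0 ∧ X ^ (n - 1) ∣
        C a * ∏ i, (C (α i) * X - C (β i)) ^ p i - C b * ∏ i, (C (α i) * X - C (β i)) ^ q i := by
  classical
  set u : Fin n → ℤ[X] := fun i => C (α i) * X - C (β i) with hu
  obtain ⟨r, hr, hsum, hdvd⟩ := exists_int_combination_X_pow_dvd hn
    fun i => derivative (u i) * ∏ j ∈ univ.erase i, u j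
  have hu0 : ∀ i, (u i).coeff 0 ≠ 0 := fun i => by simp [hu, hβ i]
  have hprod0 : ∀ p : Fin n → ℕ, (∏ i, u i ^ p i).coeff 0 ≠ 0 := fun p => by
    rw [coeff_zero_prod]
    exact prod_ne_zero_iff.mpr fun i _ => by
      rw [coeff_zero_eq_eval_zero, eval_pow, ← coeff_zero_eq_eval_zero]
      exact pow_ne_zero _ (hu0 i)
  have hpq : ∀ i, ((r i).toNat : ℤ) - ((-r i).toNat : ℤ) = r i := fun i => by omega
  have hsum' : ∑ i, (r i).toNat = ∑ i, (-r i).toNat := by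
    have : ∑ i, (((r i).toNat : ℤ) - ((-r i).toNat : ℤ)) = 0 := by simpa [hpq] using hsum
    rw [sum_sub_distrib, sub_eq_zero] at this
    exact_mod_cast this
  refine ⟨fun i => (r i).toNat, fun i => (-r i).toNat, fun i => by dsimp only; omega, hsum', ?_, ?_⟩
  · rw [Nat.pos_iff_ne_zero]
    intro h
    have h' := hsum' ▸ h
    rw [sum_eq_zero_iff] at h h'
    exact hr (funext fun i => by
      have h₁ := h i (mem_univ i)
      have h₂ := h' i (mem_univ i)
      simp only [Pi.zero_apply] at h₁ h₂ ⊢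
      omega)
  · set P := ∏ i, u i ^ (r i).toNat with hP
    set Q := ∏ i, u i ^ (-r i).toNat with hQ
    refine ⟨Q.coeff 0, P.coeff 0, hprod0 _, hprod0 _, ?_⟩
    have hn' : n - 1 = (n - 2) + 1 := by omega
    rw [hn']
    refine X_pow_succ_dvd_of_dvd_wronskian (Q := Q) (by simp [mul_comm]) (hprod0 _) _ ?_
    have hU : X ^ (n - 2) ∣ (derivative P * Q - P * derivative Q) * ∏ i, u i := by
      have h₁ := derivative_prod_pow_mul_prod u fun i => (r i).toNat
      have h₂ := derivative_prod_pow_mul_prod u fun i => (-r i).toNat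
      have : (derivative P * Q - P * derivative Q) * ∏ i, u i =
          P * Q * ∑ i, C (r i) * (derivative (u i) * ∏ j ∈ univ.erase i, u j) := by
        have h₃ : ∑ i, C (r i) * (derivative (u i) * ∏ j ∈ univ.erase i, u j) =
            ∑ i, C (((r i).toNat : ℤ)) * (derivative (u i) * ∏ j ∈ univ.erase i, u j) -
            ∑ i, C (((-r i).toNat : ℤ)) * (derivative (u i) * ∏ j ∈ univ.erase i, u j) := by
          rw [← sum_sub_distrib]
          refine sum_congr rfl fun i _ => ?_
          rw [← sub_mul, ← C_sub, hpq]
        rw [h₃]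
        linear_combination Q * h₁ - P * h₂
      rw [this]
      exact hdvd.mul_left _
    have hcop : X ^ (n - 2) ∣ derivative P * Q - P * derivative Q := by
      refine (prime_X.pow_dvd_of_dvd_mul_right _ ?_ hU)
      rw [X_dvd_iff]
      simpa using hprod0 fun _ => 1
    have : derivative (C (Q.coeff 0) * P - C (P.coeff 0) * Q) * Q -
        (C (Q.coeff 0) * P - C (P.coeff 0) * Q) * derivative Q =
        C (Q.coeff 0) * (derivative P * Q - P * derivative Q) := by
      simp only [derivative_sub, derivative_C_mul]
      ring
    rw [this]
    exact hcop.mul_left _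

theorem radN_pos (k : ℕ) : 0 < radN k :=
  prod_pos fun _ hp => (Nat.prime_of_mem_primeFactors hp).pos

theorem radN_le_self {k : ℕ} (hk : k ≠ 0) : radN k ≤ k :=
  Nat.le_of_dvd (Nat.pos_of_ne_zero hk) (Nat.prod_primeFactors_dvd k)

theorem radN_le_radN {k l : ℕ} (hl : l ≠ 0) (h : ∀ p, p.Prime → p ∣ k → p ∣ l) :
    radN k ≤ radN l := by
  refine prod_le_prod_of_subset_of_one_le' (fun p hp => ?_)
    fun p hp _ => (Nat.prime_of_mem_primeFactors hp).one_le
  rw [Nat.mem_primeFactors] at hp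
  exact Nat.mem_primeFactors.mpr ⟨hp.1, h p hp.1 hp.2.1, hl⟩

theorem radN_mul_le {k l : ℕ} (hk : k ≠ 0) (hl : l ≠ 0) : radN (k * l) ≤ radN k * radN l := by
  unfold radN
  rw [Nat.primeFactors_mul hk hl, ← prod_union_inter]
  exact Nat.le_mul_of_pos_right _
    (prod_pos fun _ hp => (Nat.prime_of_mem_primeFactors (mem_inter.mp hp).1).pos)

theorem radN_prod_le {ι : Type*} (s : Finset ι) (f : ι → ℕ) (hf : ∀ i ∈ s, f i ≠ 0) :
    radN (∏ i ∈ s, f i) ≤ ∏ i ∈ s, radN (f i) := by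
  classical
  induction s using Finset.induction_on with
  | empty => simp [radN]
  | insert i s hi ih =>
    rw [prod_insert hi, prod_insert hi]
    have hs : ∀ j ∈ s, f j ≠ 0 := fun j hj => hf j (mem_insert_of_mem hj)
    exact (radN_mul_le (hf i (mem_insert_self i s)) (prod_ne_zero_iff.mpr hs)).trans
      (Nat.mul_le_mul_left _ (ih hs))

theorem phiM_spec {m k : ℕ} (hm : m ≠ 0) (hk : k ≠ 0) :
    0 < phiM m k ∧ ∃ t : ℕ, k * phiM m k = t ^ m := by
  refine Nat.sInf_mem (s := {d : ℕ | 0 < d ∧ ∃ t : ℕ, k * d = t ^ m})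
    ⟨k ^ (m - 1), pow_pos (Nat.pos_of_ne_zero hk) _, k, ?_⟩
  rw [mul_comm, pow_sub_one_mul hm]

theorem radN_le_rpow_mul_phiM_rpow {m k : ℕ} (hm : m ≠ 0) (hk : k ≠ 0) :
    (radN k : ℝ) ≤ (k : ℝ) ^ ((m : ℝ)⁻¹) * (phiM m k : ℝ) ^ ((m : ℝ)⁻¹) := by
  obtain ⟨hpos, t, ht⟩ := phiM_spec hm hk
  have ht0 : t ≠ 0 := by
    rintro rfl
    rw [zero_pow hm] at ht
    exact (Nat.mul_pos (Nat.pos_of_ne_zero hk) hpos).ne' ht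
  have h : radN k ≤ t := (radN_le_radN ht0 fun p hp hpk =>
    hp.dvd_of_dvd_pow (ht ▸ hpk.mul_right _)).trans (radN_le_self ht0)
  rw [← Real.mul_rpow (Nat.cast_nonneg _) (Nat.cast_nonneg _), ← Nat.cast_mul, ht, Nat.cast_pow,
    Real.pow_rpow_inv_natCast (Nat.cast_nonneg _) hm]
  exact_mod_cast h

theorem Nat.gcd_prod_dvd_prod_gcd {ι : Type*} (s : Finset ι) (f : ι → ℕ) (b : ℕ) :
    Nat.gcd (∏ i ∈ s, f i) b ∣ ∏ i ∈ s, Nat.gcd (f i) b := by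
  classical
  induction s using Finset.induction_on with
  | empty => simp
  | insert i s hi ih =>
    rw [prod_insert hi, prod_insert hi]
    rw [Nat.gcd_comm, Nat.gcd_comm (f i)]
    refine (Nat.gcd_mul_right_dvd_mul_gcd b _ _).trans (mul_dvd_mul_left _ ?_)
    rwa [Nat.gcd_comm]

theorem Nat.gcd_pow_pow_dvd (a b p q : ℕ) : Nat.gcd (a ^ p) (b ^ q) ∣ Nat.gcd a b ^ (p * q) := by
  have h : ∀ c d r : ℕ, Nat.gcd (c ^ r) d ∣ Nat.gcd c d ^ r := fun c d r => by
    simpa using Nat.gcd_prod_dvd_prod_gcd (range r) (fun _ => c) d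
  rw [mul_comm, pow_mul]
  refine (h a (b ^ q) p).trans (pow_dvd_pow_of_dvd ?_ p)
  rw [Nat.gcd_comm, Nat.gcd_comm a]
  exact h b a q

theorem Nat.gcd_prod_pow_dvd {ι : Type*} [Fintype ι] (f : ι → ℕ) (p q : ι → ℕ) :
    Nat.gcd (∏ i, f i ^ p i) (∏ i, f i ^ q i) ∣ ∏ i, ∏ j, Nat.gcd (f i) (f j) ^ (p i * q j) := by
  refine (Nat.gcd_prod_dvd_prod_gcd _ _ _).trans (prod_dvd_prod_of_dvd _ _ fun i _ => ?_)
  rw [Nat.gcd_comm]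
  refine (Nat.gcd_prod_dvd_prod_gcd _ _ _).trans (prod_dvd_prod_of_dvd _ _ fun j _ => ?_)
  rw [Nat.gcd_comm]
  exact Nat.gcd_pow_pow_dvd _ _ _ _

theorem gcd_ell_dvd {α β α' β' x y : ℤ} (hxy : IsCoprime x y) :
    Nat.gcd (ell α β x y).natAbs (ell α' β' x y).natAbs ∣ (α * β' - α' * β).natAbs := by
  obtain ⟨s, t, hst⟩ := hxy
  rw [← Int.gcd_eq_natAbs_gcd_natAbs]
  rw [← Int.natCast_dvd]
  have h₁ : (Int.gcd (ell α β x y) (ell α' β' x y) : ℤ) ∣ ell α β x y := Int.gcd_dvd_left ..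
  have h₂ : (Int.gcd (ell α β x y) (ell α' β' x y) : ℤ) ∣ ell α' β' x y := Int.gcd_dvd_right ..
  have : α * β' - α' * β =
      ell α β x y * (s * α' + t * β') - ell α' β' x y * (s * α + t * β) := by
    unfold ell
    linear_combination (-(α * β' - α' * β)) * hst
  rw [this]
  exact dvd_sub (h₁.mul_right _) (h₂.mul_right _)

theorem ABCConjecture.int (habc : ABCConjecture) {ε : ℝ} (hε : 0 < ε) :
    ∃ C : ℝ, 0 < C ∧ ∀ a b c : ℤ, a ≠ 0 → b ≠ 0 → c ≠ 0 → IsCoprime a b → a - b = c →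
      ((max |a| |b| : ℤ) : ℝ) ≤ C * (radN (a * b * c).natAbs : ℝ) ^ (1 + ε) := by
  obtain ⟨C, hC, h⟩ := habc ε hε
  refine ⟨C, hC, fun a b c ha hb hc hab habc' => ?_⟩
  have ha' := Int.natAbs_pos.mpr ha
  have hb' := Int.natAbs_pos.mpr hb
  have hc' := Int.natAbs_pos.mpr hc
  have hcop : ∀ z w : ℤ, IsCoprime z w → Nat.Coprime z.natAbs w.natAbs := fun z w h =>
    Int.isCoprime_iff_gcd_eq_one.mp h
  have hac : IsCoprime a c := by
    obtain ⟨s, t, hst⟩ := hab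
    exact ⟨s + t, -t, by rw [← habc']; linear_combination hst⟩
  have hbc : IsCoprime b c := by
    obtain ⟨s, t, hst⟩ := hab
    exact ⟨s + t, s, by rw [← habc']; linear_combination hst⟩
  have hle : ∀ k : ℕ, a.natAbs ≤ k → b.natAbs ≤ k → ((max |a| |b| : ℤ) : ℝ) ≤ k := by
    intro k h₁ h₂
    have : max |a| |b| ≤ (k : ℤ) := by
      rw [Int.abs_eq_natAbs, Int.abs_eq_natAbs]
      exact_mod_cast max_le h₁ h₂
    exact_mod_cast this
  rw [Int.natAbs_mul, Int.natAbs_mul]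
  have hcases : a.natAbs + b.natAbs = c.natAbs ∨ a.natAbs + c.natAbs = b.natAbs ∨
      b.natAbs + c.natAbs = a.natAbs := by omega
  rcases hcases with hs | hs | hs
  · exact (hle c.natAbs (by lia) (by lia)).trans (h _ _ _ ha' hb' hc' (hcop _ _ hab) hs)
  · rw [mul_right_comm]
    exact (hle b.natAbs (by lia) (by lia)).trans (h _ _ _ ha' hc' hb' (hcop _ _ hac) hs)
  · rw [mul_assoc, mul_comm a.natAbs]
    exact (hle a.natAbs (by lia) (by lia)).trans (h _ _ _ hb' hc' ha' (hcop _ _ hbc) hs)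

open Polynomial in
theorem exists_homogeneous_cofactor {n : ℕ} {α β : Fin n → ℤ} {p q : Fin n → ℕ}
    (hpq : ∑ i, p i = ∑ i, q i) {a b : ℤ} {N : ℕ}
    (hdvd : X ^ N ∣
      C a * ∏ i, (C (α i) * X - C (β i)) ^ p i - C b * ∏ i, (C (α i) * X - C (β i)) ^ q i) :
    ∃ K : ℤ, 0 < K ∧ ∀ x y : ℤ, x ≠ 0 → ∃ c : ℤ,
      a * ∏ i, ell (α i) (β i) x y ^ p i - b * ∏ i, ell (α i) (β i) x y ^ q i = y ^ N * c ∧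
      |c| * max |x| |y| ^ N ≤ K * max |x| |y| ^ (∑ i, p i) := by
  obtain ⟨G, hG⟩ := hdvd
  set D := ∑ i, p i with hD
  have hdeg : ∀ r : Fin n → ℕ, (∏ i, (C (α i) * X - C (β i)) ^ r i).natDegree ≤ ∑ i, r i :=
    fun r => by
      refine (natDegree_prod_le _ _).trans (sum_le_sum fun i _ => ?_)
      refine natDegree_pow_le.trans ((Nat.mul_le_mul_left _ ?_).trans (mul_one _).le)
      compute_degree
  have hE : (C a * ∏ i, (C (α i) * X - C (β i)) ^ p i -
      C b * ∏ i, (C (α i) * X - C (β i)) ^ q i).natDegree ≤ D :=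
    (natDegree_sub_le_of_le ((natDegree_C_mul_le _ _).trans (hdeg p))
      ((natDegree_C_mul_le _ _).trans (hdeg q))).trans (by rw [← hpq, max_self])
  have hhom : ∀ (x y : ℤ), x ≠ 0 → ∀ r : Fin n → ℕ, (x : ℚ) ^ (∑ i, r i) *
      aeval ((y : ℚ) / x) (∏ i, (C (α i) * X - C (β i)) ^ r i) =
        ((∏ i, ell (α i) (β i) x y ^ r i : ℤ) : ℚ) := by
    intro x y hx r
    have hx' : (x : ℚ) ≠ 0 := Int.cast_ne_zero.mpr hx
    rw [map_prod, ← prod_pow_eq_pow_sum, ← prod_mul_distrib, Int.cast_prod]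
    refine prod_congr rfl fun i _ => ?_
    simp only [map_pow, map_sub, map_mul, aeval_X, aeval_C, ell, Int.cast_pow, Int.cast_sub,
      Int.cast_mul, algebraMap_int_eq, Int.coe_castRingHom]
    rw [← mul_pow]
    congr 1
    field_simp
  have hval : ∀ (x y : ℤ), x ≠ 0 → ((a * ∏ i, ell (α i) (β i) x y ^ p i -
      b * ∏ i, ell (α i) (β i) x y ^ q i : ℤ) : ℚ) =
        (x : ℚ) ^ D * (((y : ℚ) / x) ^ N * aeval ((y : ℚ) / x) G) := by
    intro x y hx
    have := congrArg (aeval ((y : ℚ) / x)) hG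
    rw [map_mul, map_pow, aeval_X] at this
    rw [← this, Int.cast_sub, Int.cast_mul, Int.cast_mul, ← hhom x y hx, ← hhom x y hx, ← hpq, ← hD]
    simp only [map_sub, map_mul, aeval_C, algebraMap_int_eq, Int.coe_castRingHom]
    ring
  rcases eq_or_ne G 0 with rfl | hG0
  · refine ⟨1, one_pos, fun x y hx => ⟨0, ?_, ?_⟩⟩
    · have := hval x y hx
      rw [map_zero, mul_zero, mul_zero] at this
      rw [mul_zero]
      exact_mod_cast this
    · rw [abs_zero, zero_mul]
      positivity
  · rw [hG, natDegree_X_pow_mul _ hG0] at hE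
    set s := D - N with hs
    refine ⟨∑ k ∈ range (s + 1), |G.coeff k| + 1, by positivity, fun x y hx =>
      ⟨∑ k ∈ range (s + 1), G.coeff k * (y ^ k * x ^ (s - k)), ?_, ?_⟩⟩
    · have hx' : (x : ℚ) ≠ 0 := Int.cast_ne_zero.mpr hx
      have := hval x y hx
      rw [aeval_eq_sum_range' (show G.natDegree < s + 1 by omega),
        show D = N + s by omega, pow_add, div_pow] at this
      have h₂ : (x : ℚ) ^ N * x ^ s * ((y : ℚ) ^ N / x ^ N *
          ∑ k ∈ range (s + 1), G.coeff k • ((y : ℚ) / x) ^ k) = y ^ N *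
          ∑ k ∈ range (s + 1), (G.coeff k : ℚ) * (y ^ k * x ^ (s - k)) := by
        have : (x : ℚ) ^ N * x ^ s * ((y : ℚ) ^ N / x ^ N *
          ∑ k ∈ range (s + 1), G.coeff k • ((y : ℚ) / x) ^ k) = y ^ N * (x ^ s *
            ∑ k ∈ range (s + 1), G.coeff k • ((y : ℚ) / x) ^ k) := by
          field_simp
        rw [this, mul_sum]
        congr 1
        refine sum_congr rfl fun k hk => ?_
        have hk' : s = (s - k) + k := by have := mem_range.mp hk; omega
        rw [zsmul_eq_mul, div_pow]
        nth_rw 1 [hk']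
        rw [pow_add]
        field_simp
      rw [h₂] at this
      exact_mod_cast this
    · set M := max |x| |y| with hM
      have hM1 : 1 ≤ M := (Int.one_le_abs hx).trans (le_max_left _ _)
      have hbd : |∑ k ∈ range (s + 1), G.coeff k * (y ^ k * x ^ (s - k))| ≤
          (∑ k ∈ range (s + 1), |G.coeff k|) * M ^ s := by
        rw [sum_mul]
        refine (abs_sum_le_sum_abs _ _).trans (sum_le_sum fun k hk => ?_)
        have hk' : s = k + (s - k) := by have := mem_range.mp hk; omega
        rw [abs_mul, abs_mul, abs_pow, abs_pow]
        refine mul_le_mul_of_nonneg_left ?_ (abs_nonneg _)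
        calc |y| ^ k * |x| ^ (s - k) ≤ M ^ k * M ^ (s - k) := by
              gcongr
              · exact le_max_right _ _
              · exact le_max_left _ _
          _ = M ^ s := by rw [← pow_add, ← hk']
      calc _ ≤ (∑ k ∈ range (s + 1), |G.coeff k|) * M ^ s * M ^ N := by gcongr
        _ = (∑ k ∈ range (s + 1), |G.coeff k|) * M ^ D := by
            rw [mul_assoc, ← pow_add, show s + N = D by omega]
        _ ≤ _ := by gcongr; omega

theorem exists_max_le_mul_max_ell {n : ℕ} (α β : Fin n → ℤ)
    (hdist : ∀ i j, i ≠ j → α i * β j ≠ α j * β i) :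
    ∃ K : ℤ, 0 < K ∧ ∀ x y : ℤ, ∀ i j, i ≠ j →
      max |x| |y| ≤ K * max |ell (α i) (β i) x y| |ell (α j) (β j) x y| := by
  refine ⟨2 * ∑ i, (|α i| + |β i|) + 1, by positivity, fun x y i j hij => ?_⟩
  set S := ∑ i, (|α i| + |β i|)
  have hS : ∀ i, |α i| + |β i| ≤ S := fun i =>
    single_le_sum (f := fun i => |α i| + |β i|) (fun _ _ => by positivity) (mem_univ i)
  set u := ell (α i) (β i) x y with hu
  set v := ell (α j) (β j) x y with hv
  have hΔ : 1 ≤ |α i * β j - α j * β i| := Int.one_le_abs (sub_ne_zero.mpr (hdist i j hij))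
  have key : ∀ z s t : ℤ, (α i * β j - α j * β i) * z = s * u - t * v → |s| ≤ S → |t| ≤ S →
      |z| ≤ (2 * S + 1) * max |u| |v| := fun z s t h hs ht => by
    have hm : 0 ≤ max |u| |v| := (abs_nonneg u).trans (le_max_left _ _)
    calc |z| ≤ |α i * β j - α j * β i| * |z| := le_mul_of_one_le_left (abs_nonneg z) hΔ
      _ = |s * u - t * v| := by rw [← abs_mul, h]
      _ ≤ |s| * |u| + |t| * |v| := by
          rw [← abs_mul, ← abs_mul]; exact abs_sub _ _
      _ ≤ S * max |u| |v| + S * max |u| |v| := by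
          gcongr
          · exact le_max_left _ _
          · exact le_max_right _ _
      _ ≤ _ := by linarith
  have h₁ := hS i
  have h₂ := hS j
  have := abs_nonneg (α i)
  have := abs_nonneg (α j)
  have := abs_nonneg (β i)
  have := abs_nonneg (β j)
  refine max_le (key x (α j) (α i) ?_ (by linarith) (by linarith))
    (key y (β j) (β i) ?_ (by linarith) (by linarith)) <;>
  · simp only [hu, hv, ell]
    ring

theorem pow_le_pow_mul_max_prod_pow {ι : Type*} [Fintype ι] {v : ι → ℤ} {M K : ℤ}
    (hM : 0 ≤ M) (hK : 0 < K) (h : ∀ i j, i ≠ j → M ≤ K * max |v i| |v j|) {p q : ι → ℕ}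
    (hpq : ∀ i, p i = 0 ∨ q i = 0) (hsum : ∑ i, p i = ∑ i, q i) :
    M ^ (∑ i, p i) ≤ K ^ (∑ i, p i) * max |∏ i, v i ^ p i| |∏ i, v i ^ q i| := by
  have key : ∀ r : ι → ℕ, (∀ i, r i ≠ 0 → M ≤ K * |v i|) →
      M ^ (∑ i, r i) ≤ K ^ (∑ i, r i) * |∏ i, v i ^ r i| := by
    intro r hr
    rw [abs_prod, ← prod_pow_eq_pow_sum, ← prod_pow_eq_pow_sum, ← prod_mul_distrib]
    refine prod_le_prod (fun _ _ => by positivity) fun i _ => ?_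
    rw [abs_pow, ← mul_pow]
    rcases eq_or_ne (r i) 0 with h0 | h0
    · simp [h0]
    · exact pow_le_pow_left₀ hM (hr i h0) _
  by_cases hp : ∀ i, p i ≠ 0 → M ≤ K * |v i|
  · exact (key p hp).trans (mul_le_mul_of_nonneg_left (le_max_left _ _) (by positivity))
  · push Not at hp
    obtain ⟨i, hi, hlt⟩ := hp
    rw [hsum]
    refine (key q fun j hj => ?_).trans
      (mul_le_mul_of_nonneg_left (le_max_right _ _) (by positivity))
    have hij : i ≠ j := by
      rintro rfl
      exact (hpq i).elim hi hj
    have := h i j hij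
    rw [mul_max_of_nonneg _ _ hK.le, le_max_iff] at this
    exact this.resolve_left hlt.not_ge

theorem inv_mul_rpow_le_of_rpow_le {M D ν η C₁ C₂ R : ℝ} (hM : 1 ≤ M) (hD : 0 < D) (hη : 0 < η)
    (hC₁ : 0 < C₁) (hC₂ : 0 < C₂) (hR : 0 ≤ R)
    (h : M ^ D ≤ C₁ * (C₂ * R * M ^ (D + 2 - ν)) ^ (1 + η / D)) :
    (C₁ ^ (1 + η / D)⁻¹ * C₂)⁻¹ * M ^ (ν - 2 - η) ≤ R := by
  have hM0 : 0 < M := one_pos.trans_le hM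
  have hε : 0 < η / D := div_pos hη hD
  have he : 0 < 1 + η / D := by linarith
  rw [inv_mul_le_iff₀ (by positivity)]
  have h₁ := Real.rpow_le_rpow (by positivity) h (inv_nonneg.mpr he.le)
  rw [Real.mul_rpow hC₁.le (by positivity), Real.rpow_rpow_inv (by positivity) he.ne',
    ← Real.rpow_mul hM0.le] at h₁
  have h₂ : D - η ≤ D * (1 + η / D)⁻¹ := by
    rw [← div_eq_mul_inv, le_div_iff₀ he]
    have : (D - η) * (1 + η / D) = D - η * (η / D) := by field_simp; ring
    rw [this]
    have : 0 < η * (η / D) := by positivity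
    linarith
  have h₃ := (Real.rpow_le_rpow_of_exponent_le hM h₂).trans h₁
  have h₄ : M ^ (D - η) = M ^ (ν - 2 - η) * M ^ (D + 2 - ν) := by
    rw [← Real.rpow_add hM0]; congr 1; ring
  rw [h₄] at h₃
  refine le_of_mul_le_mul_right (h₃.trans (le_of_eq ?_)) (Real.rpow_pos_of_pos hM0 (D + 2 - ν))
  ring

theorem IsCoprime.ne_zero_of_one_lt_max_abs {x y : ℤ} (hxy : IsCoprime x y) (h : 1 < max |x| |y|) :
    x ≠ 0 := by
  rintro rfl
  have := Int.isUnit_iff_abs_eq.mp (isCoprime_zero_left.mp hxy)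
  simp [this] at h

theorem radN_natAbs_le {n : ℕ} {v : Fin n → ℤ} (hv : ∀ i, v i ≠ 0) {a b y c : ℤ} (ha : a ≠ 0)
    (hb : b ≠ 0) (hy : y ≠ 0) (hc : c ≠ 0) {p q : Fin n → ℕ} {N : ℕ} {u : ℤ}
    (hu : u ∣ (a * ∏ i, v i ^ p i) * (b * ∏ i, v i ^ q i) * (y ^ N * c)) :
    (radN u.natAbs : ℝ) ≤
      (|a * b| : ℤ) * (∏ i, (radN (v i).natAbs : ℝ)) * (|y| * |c| : ℤ) := by
  have hV : ∏ i, (v i).natAbs ≠ 0 := prod_ne_zero_iff.mpr fun i _ => Int.natAbs_ne_zero.mpr (hv i)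
  have hab : (a * b).natAbs ≠ 0 := Int.natAbs_ne_zero.mpr (mul_ne_zero ha hb)
  have hyc : (y * c).natAbs ≠ 0 := Int.natAbs_ne_zero.mpr (mul_ne_zero hy hc)
  have h₁ : radN u.natAbs ≤ radN ((a * b).natAbs * (∏ i, (v i).natAbs) * (y * c).natAbs) := by
    refine radN_le_radN (mul_ne_zero (mul_ne_zero hab hV) hyc) fun l hl hlu => ?_
    have hlp := Nat.prime_iff_prime_int.mp hl
    have hd := (Int.natCast_dvd.mpr hlu).trans hu
    have hprod : ∀ r : Fin n → ℕ, (l : ℤ) ∣ ∏ i, v i ^ r i → l ∣ ∏ i, (v i).natAbs := by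
      intro r hr
      obtain ⟨i, hi, hd⟩ := (Prime.dvd_finsetProd_iff hlp _).mp hr
      exact (Int.natCast_dvd.mp (hlp.dvd_of_dvd_pow hd)).trans (dvd_prod_of_mem _ hi)
    rw [hlp.dvd_mul, hlp.dvd_mul, hlp.dvd_mul, hlp.dvd_mul, hlp.dvd_mul] at hd
    rw [hl.dvd_mul, hl.dvd_mul, Int.natAbs_mul, Int.natAbs_mul, hl.dvd_mul, hl.dvd_mul]
    rcases hd with ((hd | hd) | (hd | hd)) | (hd | hd)
    · exact Or.inl (Or.inl (Or.inl (Int.natCast_dvd.mp hd)))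
    · exact Or.inl (Or.inr (hprod p hd))
    · exact Or.inl (Or.inl (Or.inr (Int.natCast_dvd.mp hd)))
    · exact Or.inl (Or.inr (hprod q hd))
    · exact Or.inr (Or.inl (Int.natCast_dvd.mp (hlp.dvd_of_dvd_pow hd)))
    · exact Or.inr (Or.inr (Int.natCast_dvd.mp hd))
  have h₂ : radN u.natAbs ≤
      (a * b).natAbs * (∏ i, radN (v i).natAbs) * (y * c).natAbs :=
    h₁.trans <| (radN_mul_le (mul_ne_zero hab hV) hyc).trans <| Nat.mul_le_mul
      ((radN_mul_le hab hV).trans <| Nat.mul_le_mul (radN_le_self hab)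
        (radN_prod_le _ _ fun i _ => Int.natAbs_ne_zero.mpr (hv i))) (radN_le_self hyc)
  rw [← abs_mul y c, ← Nat.cast_natAbs, ← Nat.cast_natAbs]
  exact_mod_cast h₂

theorem exists_gcd_le {n : ℕ} (α β : Fin n → ℤ) (hdist : ∀ i j, i ≠ j → α i * β j ≠ α j * β i)
    {p q : Fin n → ℕ} (hpq : ∀ i, p i = 0 ∨ q i = 0) {a b : ℤ} (ha : a ≠ 0) (hb : b ≠ 0) :
    ∃ R : ℕ, 0 < R ∧ ∀ x y : ℤ, IsCoprime x y →
      Int.gcd (a * ∏ i, ell (α i) (β i) x y ^ p i) (b * ∏ i, ell (α i) (β i) x y ^ q i) ≤ R := by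
  have hR : 0 < b.natAbs * (a.natAbs *
      ∏ i, ∏ j, (α i * β j - α j * β i).natAbs ^ (p i * q j)) := by
    refine Nat.mul_pos (Int.natAbs_pos.mpr hb) (Nat.mul_pos (Int.natAbs_pos.mpr ha)
      (prod_pos fun i _ => prod_pos fun j _ => ?_))
    rcases eq_or_ne i j with rfl | hij
    · rcases hpq i with h | h <;> simp [h]
    · exact pow_pos (Int.natAbs_pos.mpr (sub_ne_zero.mpr (hdist i j hij))) _
  refine ⟨_, hR, fun x y hxy => Nat.le_of_dvd hR ?_⟩
  have habs : ∀ r : Fin n → ℕ, (∏ i, ell (α i) (β i) x y ^ r i).natAbs =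
      ∏ i, (ell (α i) (β i) x y).natAbs ^ r i := fun r =>
    (map_prod Int.natAbsHom (fun i => ell (α i) (β i) x y ^ r i) univ).trans
      (prod_congr rfl fun i _ => Int.natAbs_pow _ _)
  rw [Int.gcd_eq_natAbs_gcd_natAbs, Int.natAbs_mul, Int.natAbs_mul, habs, habs]
  refine (Nat.gcd_mul_right_dvd_mul_gcd _ _ _).trans
    (mul_dvd_mul (Nat.gcd_dvd_right _ _) ?_)
  rw [Nat.gcd_comm]
  refine (Nat.gcd_mul_right_dvd_mul_gcd _ _ _).trans
    (mul_dvd_mul (Nat.gcd_dvd_right _ _) ?_)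
  rw [Nat.gcd_comm]
  refine (Nat.gcd_prod_pow_dvd _ _ _).trans (prod_dvd_prod_of_dvd _ _ fun i _ =>
    prod_dvd_prod_of_dvd _ _ fun j _ => pow_dvd_pow_of_dvd (gcd_ell_dvd hxy) _)

theorem ABCConjecture.exists_le_prod_radN_of_ne_zero (habc : ABCConjecture) {n : ℕ} (hn : 2 ≤ n)
    (α β : Fin n → ℤ) (hβ : ∀ i, β i ≠ 0) (hdist : ∀ i j, i ≠ j → α i * β j ≠ α j * β i)
    {η : ℝ} (hη : 0 < η) :
    ∃ c : ℝ, 0 < c ∧ ∃ B : ℤ, ∀ x y : ℤ, IsCoprime x y → (∀ i, ell (α i) (β i) x y ≠ 0) →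
      B < max |x| |y| →
      c * ((max |x| |y| : ℤ) : ℝ) ^ ((n : ℝ) - 2 - η) ≤
        ∏ i, (radN (ell (α i) (β i) x y).natAbs : ℝ) := by
  obtain ⟨p, q, hpq, hsum, hpos, a, b, ha, hb, hdvd⟩ := exists_belyi_exponents hn α β hβ
  obtain ⟨K, hK, hKle⟩ := exists_max_le_mul_max_ell α β hdist
  obtain ⟨L, hL, hLle⟩ := exists_homogeneous_cofactor hsum hdvd
  obtain ⟨R, hR, hRle⟩ := exists_gcd_le α β hdist hpq ha hb
  set D := ∑ i, p i with hD
  have hDpos : (0 : ℝ) < D := Nat.cast_pos.mpr hpos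
  obtain ⟨C, hC, habcC⟩ := habc.int (div_pos hη hDpos)
  have hC₁ : (0 : ℝ) < (K : ℝ) ^ D * R * C :=
    mul_pos (mul_pos (pow_pos (Int.cast_pos.mpr hK) D) (Nat.cast_pos.mpr hR)) hC
  have hab : 0 < |a * b| := abs_pos.mpr (mul_ne_zero ha hb)
  have hC₂ : (0 : ℝ) < (|a * b| : ℤ) * (L : ℝ) := by exact_mod_cast mul_pos hab hL
  refine ⟨_, inv_pos.mpr (mul_pos (Real.rpow_pos_of_pos hC₁ (1 + η / D)⁻¹) hC₂), K ^ D * R,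
    fun x y hxy hv hB => ?_⟩
  set M := max |x| |y| with hM
  have hKR : 1 ≤ K ^ D * R := Int.add_one_le_iff.mpr (mul_pos (pow_pos hK D) (Nat.cast_pos.mpr hR))
  have hM1 : 1 < M := lt_of_le_of_lt hKR hB
  have hx : x ≠ 0 := IsCoprime.ne_zero_of_one_lt_max_abs hxy hM1
  have hy : y ≠ 0 := IsCoprime.ne_zero_of_one_lt_max_abs hxy.symm (max_comm |x| |y| ▸ hM1)
  obtain ⟨c, hc, hcle⟩ := hLle x y hx
  set P := ∏ i, ell (α i) (β i) x y ^ p i with hP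
  set Q := ∏ i, ell (α i) (β i) x y ^ q i with hQ
  have hP0 : P ≠ 0 := prod_ne_zero_iff.mpr fun i _ => pow_ne_zero _ (hv i)
  have hQ0 : Q ≠ 0 := prod_ne_zero_iff.mpr fun i _ => pow_ne_zero _ (hv i)
  have hlow : M ^ D ≤ K ^ D * max |a * P| |b * Q| := by
    refine (pow_le_pow_mul_max_prod_pow (by omega) hK (fun i j hij => hKle x y i j hij) hpq
      hsum).trans (mul_le_mul_of_nonneg_left (max_le_max ?_ ?_) (by positivity))
    · rw [abs_mul]; exact le_mul_of_one_le_left (abs_nonneg _) (Int.one_le_abs ha)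
    · rw [abs_mul]; exact le_mul_of_one_le_left (abs_nonneg _) (Int.one_le_abs hb)
  obtain ⟨A', B', hcop, hA, hB'⟩ := Int.exists_gcd_one
    (Int.gcd_pos_of_ne_zero_left (b * Q) (mul_ne_zero ha hP0))
  have hgR : Int.gcd (a * P) (b * Q) ≤ R := hRle x y hxy
  have hgpos : 0 < Int.gcd (a * P) (b * Q) :=
    Int.gcd_pos_of_ne_zero_left (b * Q) (mul_ne_zero ha hP0)
  generalize Int.gcd (a * P) (b * Q) = g at hA hB' hgR hgpos
  have hA0 : A' ≠ 0 := by
    rintro rfl; rw [zero_mul] at hA; exact mul_ne_zero ha hP0 hA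
  have hB0 : B' ≠ 0 := by
    rintro rfl; rw [zero_mul] at hB'; exact mul_ne_zero hb hQ0 hB'
  have hmax : max |a * P| |b * Q| ≤ R * max |A'| |B'| := by
    rw [hA, hB', abs_mul, abs_mul, Nat.abs_cast, mul_comm, mul_comm |B'|,
      ← mul_max_of_nonneg _ _ (by positivity)]
    gcongr
  have hcop' : IsCoprime A' B' := Int.isCoprime_iff_gcd_eq_one.mpr hcop
  have hAB : A' - B' ≠ 0 := by
    intro h
    rw [sub_eq_zero] at h
    subst h
    have h₁ : max |A'| |A'| = 1 := by
      rw [max_self]; exact Int.isUnit_iff_abs_eq.mp (isCoprime_self.mp hcop')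
    rw [h₁, mul_one] at hmax
    have h₂ : M ≤ M ^ D := le_self_pow₀ hM1.le hpos.ne'
    have h₃ := hlow.trans (mul_le_mul_of_nonneg_left hmax (by positivity))
    linarith
  have hABc : (A' - B') * g = y ^ (n - 1) * c := by rw [sub_mul, ← hA, ← hB', hc]
  have hc0 : c ≠ 0 := by
    rintro rfl
    rw [mul_zero] at hABc
    exact mul_ne_zero hAB (by exact_mod_cast hgpos.ne') hABc
  have hrad := radN_natAbs_le hv ha hb hy hc0 (p := p) (q := q) (N := n - 1)
    (u := A' * B' * (A' - B')) <| by
      rw [← hABc, ← hP, ← hQ, hA, hB']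
      exact mul_dvd_mul (mul_dvd_mul (dvd_mul_right _ _) (dvd_mul_right _ _)) (dvd_mul_right _ _)
  have hMR : (1 : ℝ) < M := by exact_mod_cast hM1
  have hM0 : (0 : ℝ) < M := one_pos.trans hMR
  have hyc : ((|y| * |c| : ℤ) : ℝ) ≤ L * (M : ℝ) ^ ((D : ℝ) + 2 - n) := by
    have h₁ : |y| * |c| * M ^ (n - 1) ≤ L * M ^ (D + 1) := by
      calc |y| * |c| * M ^ (n - 1) = |y| * (|c| * M ^ (n - 1)) := by ring
        _ ≤ M * (L * M ^ D) := by
            gcongr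
            exact le_max_right _ _
        _ = _ := by ring
    have h₂ : ((|y| * |c| : ℤ) : ℝ) * (M : ℝ) ^ (n - 1) ≤ L * (M : ℝ) ^ (D + 1) := by
      exact_mod_cast h₁
    refine le_of_mul_le_mul_right (h₂.trans (le_of_eq ?_)) (pow_pos hM0 (n - 1))
    rw [mul_assoc, ← Real.rpow_natCast, ← Real.rpow_natCast, ← Real.rpow_add hM0,
      Nat.cast_sub (by omega)]
    congr 2
    push_cast
    ring
  refine inv_mul_rpow_le_of_rpow_le hMR.le hDpos hη hC₁ hC₂ (by positivity) ?_
  have hlow' : (M : ℝ) ^ (D : ℝ) ≤ K ^ D * (R * (max |A'| |B'| : ℤ)) := by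
    rw [Real.rpow_natCast]
    exact_mod_cast hlow.trans (mul_le_mul_of_nonneg_left hmax (by positivity))
  refine hlow'.trans ?_
  rw [mul_assoc, mul_assoc]
  refine mul_le_mul_of_nonneg_left (mul_le_mul_of_nonneg_left ?_ (by positivity)) (by positivity)
  refine (habcC A' B' (A' - B') hA0 hB0 hAB hcop' rfl).trans ?_
  gcongr
  refine hrad.trans ((mul_le_mul_of_nonneg_left hyc (by positivity)).trans (le_of_eq ?_))
  ring

theorem exists_shear {n : ℕ} (α β : Fin n → ℤ) (h : ∀ i, IsCoprime (α i) (β i)) :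
    ∃ N : ℤ, ∀ i, β i - N * α i ≠ 0 := by
  classical
  obtain ⟨N, hN⟩ := (univ.image fun i => β i / α i).exists_notMem
  by_contra! hcon
  by_cases hall : ∀ i, α i = 0 → β i ≠ 0
  · obtain ⟨i, hi⟩ := hcon N
    rcases eq_or_ne (α i) 0 with h0 | h0
    · exact hall i h0 (by simpa [h0] using hi)
    · refine hN (mem_image.mpr ⟨i, mem_univ i, ?_⟩)
      rw [sub_eq_zero.mp hi, Int.mul_ediv_cancel _ h0]
  · push Not at hall
    obtain ⟨i, h₁, h₂⟩ := hall
    have := h i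
    rw [h₁, h₂] at this
    exact not_isCoprime_zero_zero this

theorem rpow_le_rpow_abs_mul_rpow {M M' K e : ℝ} (hM : 0 < M) (hM' : 0 < M') (hK : 0 < K)
    (h : M ≤ K * M') (h' : M' ≤ K * M) : M ^ e ≤ K ^ |e| * M' ^ e := by
  rcases le_total 0 e with he | he
  · rw [abs_of_nonneg he, ← Real.mul_rpow hK.le hM'.le]
    exact Real.rpow_le_rpow hM.le h he
  · rw [abs_of_nonpos he, Real.rpow_neg hK.le, ← Real.inv_rpow hK.le,
      ← Real.mul_rpow (inv_nonneg.mpr hK.le) hM'.le]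
    exact Real.rpow_le_rpow_of_nonpos (by positivity) ((inv_mul_le_iff₀ hK).mpr h') he

theorem ABCConjecture.exists_le_prod_radN (habc : ABCConjecture) {n : ℕ} (hn : 1 ≤ n)
    (α β : Fin n → ℤ) (hprim : ∀ i, IsCoprime (α i) (β i))
    (hdist : ∀ i j, i ≠ j → α i * β j ≠ α j * β i) {η : ℝ} (hη : 0 < η) :
    ∃ c : ℝ, 0 < c ∧ ∃ B : ℤ, ∀ x y : ℤ, IsCoprime x y → (∀ i, ell (α i) (β i) x y ≠ 0) →
      B < max |x| |y| →
      c * ((max |x| |y| : ℤ) : ℝ) ^ ((n : ℝ) - 2 - η) ≤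
        ∏ i, (radN (ell (α i) (β i) x y).natAbs : ℝ) := by
  rcases hn.eq_or_lt with rfl | hn
  · refine ⟨1, one_pos, 1, fun x y _ _ hB => ?_⟩
    have hM : (1 : ℝ) ≤ ((max |x| |y| : ℤ) : ℝ) := by exact_mod_cast hB.le
    rw [one_mul]
    refine (Real.rpow_le_one_of_one_le_of_nonpos hM (by push_cast; linarith)).trans ?_
    exact_mod_cast Nat.one_le_iff_ne_zero.mpr (prod_ne_zero_iff.mpr fun i _ => (radN_pos _).ne')
  obtain ⟨N, hN⟩ := exists_shear α β hprim
  obtain ⟨c, hc, B, h⟩ := habc.exists_le_prod_radN_of_ne_zero hn α (fun i => β i - N * α i) hN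
    (fun i j hij heq => hdist i j hij (by linear_combination heq)) hη
  have hK : (0 : ℝ) < ((1 + |N| : ℤ) : ℝ) := by
    have := abs_nonneg N
    exact_mod_cast (by omega : 0 < 1 + |N|)
  have hKe := Real.rpow_pos_of_pos hK |(n : ℝ) - 2 - η|
  refine ⟨(((1 + |N| : ℤ) : ℝ) ^ |(n : ℝ) - 2 - η|)⁻¹ * c, by positivity, (1 + |N|) * max B 1,
    fun x y hxy hv hB => ?_⟩
  have hell : ∀ i, ell (α i) (β i - N * α i) x (y - N * x) = ell (α i) (β i) x y := fun i => by
    unfold ell; ring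
  have hcop : IsCoprime x (y - N * x) := by
    obtain ⟨s, t, hst⟩ := hxy
    exact ⟨s + t * N, t, by linear_combination hst⟩
  have hle : ∀ z w k : ℤ, w = z + k * x → |k| = |N| →
      max |x| |w| ≤ (1 + |N|) * max |x| |z| := fun z w k hw hk => by
    have h₀ : 0 ≤ |N| := abs_nonneg N
    have h₁ : |x| ≤ max |x| |z| := le_max_left _ _
    have h₂ : |z| ≤ max |x| |z| := le_max_right _ _
    have h₃ : 0 ≤ |x| := abs_nonneg x
    have h₄ : |w| ≤ |z| + |N| * |x| := by
      rw [hw, ← hk, ← abs_mul]; exact abs_add_le _ _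
    have h₅ : |N| * |x| ≤ |N| * max |x| |z| := mul_le_mul_of_nonneg_left h₁ h₀
    have h₆ : 0 ≤ |N| * max |x| |z| := by positivity
    exact max_le (by linarith) (by linarith)
  have hle₁ := hle (y - N * x) y N (by ring) rfl
  have hle₂ := hle y (y - N * x) (-N) (by ring) (abs_neg N)
  have hB' : max B 1 < max |x| |y - N * x| :=
    lt_of_mul_lt_mul_left (hB.trans_le hle₁) (by positivity)
  have hM' : 0 < max |x| |y - N * x| := by omega
  have hM : 0 < max |x| |y| := by
    refine lt_trans ?_ hB
    have := abs_nonneg N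
    positivity
  have key := h x (y - N * x) hcop (fun i => by rw [hell]; exact hv i)
    ((le_max_left _ _).trans_lt hB')
  simp only [hell] at key
  refine le_trans ?_ key
  rw [mul_assoc, inv_mul_le_iff₀ hKe, mul_left_comm]
  refine mul_le_mul_of_nonneg_left ?_ hc.le
  exact rpow_le_rpow_abs_mul_rpow (by exact_mod_cast hM) (by exact_mod_cast hM') hK
    (by exact_mod_cast hle₁) (by exact_mod_cast hle₂)

theorem finite_setOf_max_abs_le (B : ℤ) : {p : ℤ × ℤ | max |p.1| |p.2| ≤ B}.Finite := by
  refine ((Set.finite_Icc (-B) B).prod (Set.finite_Icc (-B) B)).subset fun p hp => ?_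
  have h := max_le_iff.mp (show max |p.1| |p.2| ≤ B from hp)
  exact ⟨abs_le.mp h.1, abs_le.mp h.2⟩

theorem abs_ell_le (α β x y : ℤ) : |ell α β x y| ≤ (|α| + |β|) * max |x| |y| := by
  have h₁ : |α| * |y| ≤ |α| * max |x| |y| :=
    mul_le_mul_of_nonneg_left (le_max_right _ _) (abs_nonneg _)
  have h₂ : |β| * |x| ≤ |β| * max |x| |y| :=
    mul_le_mul_of_nonneg_left (le_max_left _ _) (abs_nonneg _)
  calc |ell α β x y| ≤ |α * y| + |β * x| := abs_sub _ _
    _ ≤ _ := by rw [abs_mul, abs_mul]; linarith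

/-- Assuming the `abc`-conjecture, for every `δ > δ(𝐦)` the perturbed anticanonical
height `H^δ_{(𝐚,𝐦)}` has the Northcott property. -/
theorem northcott_of_abc
    (habc : ABCConjecture)
    (n : ℕ) (hn : 1 ≤ n) (α β : Fin n → ℤ)
    (hprim : ∀ i, IsCoprime (α i) (β i))
    (hdist : ∀ i j, i ≠ j → α i * β j ≠ α j * β i)
    (m : Fin n → ℕ) (hm : ∀ i, 2 ≤ m i)
    (δ : ℝ) (hδ : deltaM m < δ) :
    HasNorthcott α β (stackyHeight α β m δ) := by
  obtain ⟨η, hη, hηδ⟩ : ∃ η : ℝ, 0 < η ∧ δ = deltaM m + 2 * η :=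
    ⟨(δ - deltaM m) / 2, by linarith, by ring⟩
  obtain ⟨c, hc, B, h⟩ := habc.exists_le_prod_radN hn α β hprim hdist hη
  intro T
  set W := ∏ i, ((|α i| + |β i| : ℤ) : ℝ) ^ ((m i : ℝ)⁻¹) with hW
  have hW0 : 0 ≤ W := prod_nonneg fun i _ => by positivity
  refine (finite_setOf_max_abs_le
    (max (max B 1) ⌈(c⁻¹ * (W * T)) ^ η⁻¹⌉)).subset fun ⟨x, y⟩ ⟨hxy, hv, hT⟩ => ?_
  show max |x| |y| ≤ _
  by_contra! hlt
  rw [max_lt_iff, max_lt_iff] at hlt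
  obtain ⟨⟨hB, h1⟩, hceil⟩ := hlt
  have key := h x y hxy hv hB
  simp only [stackyHeight] at hT
  have hM : (1 : ℝ) < ((max |x| |y| : ℤ) : ℝ) := by exact_mod_cast h1
  have hceil' : (c⁻¹ * (W * T)) ^ η⁻¹ < ((max |x| |y| : ℤ) : ℝ) := by
    refine (Int.le_ceil _).trans_lt ?_
    exact_mod_cast hceil
  have hell : ∀ i, ((ell (α i) (β i) x y).natAbs : ℝ) ≤
      ((|α i| + |β i| : ℤ) : ℝ) * ((max |x| |y| : ℤ) : ℝ) := fun i => by
    rw [Nat.cast_natAbs]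
    exact_mod_cast abs_ell_le (α i) (β i) x y
  generalize ((max |x| |y| : ℤ) : ℝ) = M at key hT hM hceil' hell
  have hM0 : 0 < M := one_pos.trans hM
  set Φ := ∏ i, (phiM (m i) (ell (α i) (β i) x y).natAbs : ℝ) ^ ((m i : ℝ)⁻¹) with hΦ
  have hrad : ∏ i, (radN (ell (α i) (β i) x y).natAbs : ℝ) ≤
      W * M ^ (∑ i, (m i : ℝ)⁻¹) * Φ := by
    rw [hW, hΦ, Real.rpow_sum_of_pos hM0, ← prod_mul_distrib, ← prod_mul_distrib]
    refine prod_le_prod (fun _ _ => by positivity) fun i _ => ?_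
    have hmi : m i ≠ 0 := by have := hm i; omega
    refine (radN_le_rpow_mul_phiM_rpow hmi
      (Int.natAbs_ne_zero.mpr (hv i))).trans ?_
    refine mul_le_mul_of_nonneg_right ?_ (by positivity)
    rw [← Real.mul_rpow (by positivity) hM0.le]
    exact Real.rpow_le_rpow (by positivity) (hell i) (by positivity)
  have hfin : c * M ^ η ≤ W * T := by
    have h₁ : M ^ η = M ^ ((n : ℝ) - 2 - η) * M ^ (δ - ∑ i, (m i : ℝ)⁻¹) := by
      rw [← Real.rpow_add hM0, hηδ, deltaM, sum_sub_distrib]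
      congr 1
      simp
      ring
    have h₂ : M ^ δ = M ^ (∑ i, (m i : ℝ)⁻¹) * M ^ (δ - ∑ i, (m i : ℝ)⁻¹) := by
      rw [← Real.rpow_add hM0]; congr 1; ring
    calc c * M ^ η = c * M ^ ((n : ℝ) - 2 - η) * M ^ (δ - ∑ i, (m i : ℝ)⁻¹) := by
          rw [h₁, mul_assoc]
      _ ≤ W * M ^ (∑ i, (m i : ℝ)⁻¹) * Φ * M ^ (δ - ∑ i, (m i : ℝ)⁻¹) :=
          mul_le_mul_of_nonneg_right (key.trans hrad) (by positivity)
      _ = W * (Φ * M ^ δ) := by rw [h₂]; ring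
      _ ≤ W * T := mul_le_mul_of_nonneg_left hT hW0
  refine hceil'.not_ge ?_
  calc M = (M ^ η) ^ η⁻¹ := (Real.rpow_rpow_inv hM0.le hη.ne').symm
    _ ≤ _ := Real.rpow_le_rpow (by positivity) ((le_inv_mul_iff₀ hc).mpr hfin) (by positivity)
end

section
/- Let F(x,y) = a4·x⁴ + a3·x³y + a2·x²y² + a1·xy³ + a0·y⁴ ∈ ℤ[x,y] be a binary quartic form with nonzero discriminant. Then there exists a nonzero squarefree integer d such that: (i) there exist rational numbers u, v, z with (u,v) ≠ (0,0) and d·z² = F(u,v); and (ii) the elliptic curve over ℚ given by y² = x³ − (d²·I(F)/3)·x − (d³·J(F)/27), which is the Jacobian of the genus one curve d·z² = F(u,v), has infinitely many rational points (equivalently, positive Mordell–Weil rank). -/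
/-- The naive (multiplicative) height of a rational number. -/
def Rat.naiveHeight (x : ℚ) : ℤ := max |x.num| x.den

theorem Rat.finite_naiveHeight_le (C : ℤ) : {x : ℚ | x.naiveHeight ≤ C}.Finite := by
  refine Set.Finite.of_finite_image (f := fun x : ℚ ↦ (x.num, (x.den : ℤ)))
    (((Set.finite_Icc (-C) C).prod (Set.finite_Icc 0 C)).subset ?_) ?_
  · rintro _ ⟨x, hx, rfl⟩
    obtain ⟨h₁, h₂⟩ := max_le_iff.mp (show max |x.num| (x.den : ℤ) ≤ C from hx)
    exact ⟨abs_le.mp h₁, by positivity, h₂⟩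
  · intro x _ y _ h
    simp only [Prod.mk.injEq, Nat.cast_inj] at h
    exact Rat.ext h.1 h.2

theorem Rat.max_abs_le_mul_naiveHeight_div {N D k : ℤ} (hD : D ≠ 0) (hk : k ≠ 0)
    (h : ∀ c, c ∣ N → c ∣ D → c ∣ k) :
    max |N| |D| ≤ |k| * ((N : ℚ) / D).naiveHeight := by
  obtain ⟨c, hN, hD'⟩ := Rat.exists_eq_mul_div_num_and_eq_mul_div_den N hD
  have hc : |c| ≤ |k| :=
    Int.le_of_dvd (abs_pos.mpr hk) ((abs_dvd_abs _ _).mpr (h c ⟨_, hN⟩ ⟨_, hD'⟩))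
  have hmax : max |N| |D| = |c| * ((N : ℚ) / D).naiveHeight := by
    rw [Rat.naiveHeight, mul_max_of_nonneg _ _ (abs_nonneg c), ← abs_mul, ← hN]
    congr 1
    conv_lhs => rw [hD', abs_mul, Nat.abs_cast]
  rw [hmax]
  exact mul_le_mul_of_nonneg_right hc (le_max_of_le_left (abs_nonneg _))

theorem abs_cubic_form_le (α β γ δ : ℤ) {m n M : ℤ} (hm : |m| ≤ M) (hn : |n| ≤ M) :
    |α * m ^ 3 + β * m ^ 2 * n + γ * m * n ^ 2 + δ * n ^ 3| ≤
      (|α| + |β| + |γ| + |δ|) * M ^ 3 := by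
  have hM : 0 ≤ M := (abs_nonneg m).trans hm
  calc _ ≤ |α * m ^ 3| + |β * m ^ 2 * n| + |γ * m * n ^ 2| + |δ * n ^ 3| := by
        refine (abs_add_le _ _).trans (add_le_add_left ((abs_add_le _ _).trans
          (add_le_add_left (abs_add_le _ _) _)) _)
    _ = |α| * |m| ^ 3 + |β| * |m| ^ 2 * |n| + |γ| * |m| * |n| ^ 2 + |δ| * |n| ^ 3 := by
        simp only [abs_mul, abs_pow]
    _ ≤ |α| * M ^ 3 + |β| * M ^ 2 * M + |γ| * M * M ^ 2 + |δ| * M ^ 3 := by gcongr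
    _ = _ := by ring

/-- A Bézout identity with cubic cofactors bounds a degree 7 power by the two quartic values. -/
theorem abs_mul_pow_four_le_of_bezout {k M N D f g l A B : ℤ} (hM : 0 < M) (hl : |l| = M)
    (hA : |f| ≤ A * M ^ 3) (hB : |g| ≤ B * M ^ 3) (h : f * N + g * D = k * l ^ 7) :
    |k| * M ^ 4 ≤ (A + B) * max |N| |D| := by
  have hM3 : 0 < M ^ 3 := by positivity
  refine le_of_mul_le_mul_right ?_ hM3
  calc |k| * M ^ 4 * M ^ 3 = |f * N + g * D| := by rw [h, abs_mul, abs_pow, hl]; ring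
    _ ≤ |f| * |N| + |g| * |D| := by simpa only [abs_mul] using abs_add_le (f * N) (g * D)
    _ ≤ A * M ^ 3 * max |N| |D| + B * M ^ 3 * max |N| |D| := by
        gcongr
        · exact (abs_nonneg f).trans hA
        · exact le_max_left _ _
        · exact (abs_nonneg g).trans hB
        · exact le_max_right _ _
    _ = _ := by ring

theorem cubic_homogenization (a b m : ℚ) {n : ℚ} (hn : n ≠ 0) :
    4 * n * (m ^ 3 + a * m * n ^ 2 + b * n ^ 3) =
      4 * n ^ 4 * ((m / n) ^ 3 + a * (m / n) + b) := by
  field_simp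

theorem quartic_homogenization (a b m : ℚ) {n : ℚ} (hn : n ≠ 0) :
    m ^ 4 - 2 * a * m ^ 2 * n ^ 2 - 8 * b * m * n ^ 3 + a ^ 2 * n ^ 4 =
      n ^ 4 * ((m / n) ^ 4 - 2 * a * (m / n) ^ 2 - 8 * b * (m / n) + a ^ 2) := by
  field_simp

theorem dvd_of_dvd_bezout_of_isCoprime {c k m n N D f₁ g₁ f₂ g₂ : ℤ} {r : ℕ}
    (hmn : IsCoprime m n) (h₁ : f₁ * N + g₁ * D = k * n ^ r) (h₂ : f₂ * N + g₂ * D = k * m ^ r)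
    (hN : c ∣ N) (hD : c ∣ D) : c ∣ k := by
  have hn : c ∣ k * n ^ r := h₁ ▸ dvd_add (hN.mul_left _) (hD.mul_left _)
  have hm : c ∣ k * m ^ r := h₂ ▸ dvd_add (hN.mul_left _) (hD.mul_left _)
  obtain ⟨u, v, huv⟩ : IsCoprime (m ^ r) (n ^ r) := hmn.pow
  have hk : k = u * (k * m ^ r) + v * (k * n ^ r) := by linear_combination -k * huv
  exact hk ▸ dvd_add (hm.mul_left _) (hn.mul_left _)

/-- Common divisors and sizes of the numerator and denominator of the duplication map
on `y² = x³ + ax + b`, homogenized. -/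
theorem exists_duplication_bound (a b : ℤ) :
    ∃ C : ℤ, 1 ≤ C ∧ ∀ m n N D : ℤ, IsCoprime m n → 0 < max |m| |n| →
      N = m ^ 4 - 2 * a * m ^ 2 * n ^ 2 - 8 * b * m * n ^ 3 + a ^ 2 * n ^ 4 →
      D = 4 * n * (m ^ 3 + a * m * n ^ 2 + b * n ^ 3) →
      (∀ c, c ∣ N → c ∣ D → c ∣ 4 * (4 * a ^ 3 + 27 * b ^ 2)) ∧
      |4 * (4 * a ^ 3 + 27 * b ^ 2)| * max |m| |n| ^ 4 ≤ C * max |N| |D| := by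
  generalize hk : 4 * (4 * a ^ 3 + 27 * b ^ 2) = k
  obtain ⟨C₁, hC₁⟩ : ∃ C₁ : ℤ, C₁ = (|0| + |12| + |0| + |16 * a|) +
    (|-3| + |0| + |5 * a| + |27 * b|) := ⟨_, rfl⟩
  obtain ⟨C₂, hC₂⟩ : ∃ C₂ : ℤ, C₂ = (|k| + |-4 * a ^ 2 * b| +
      |4 * a * (3 * a ^ 3 + 22 * b ^ 2)| + |12 * b * (a ^ 3 + 8 * b ^ 2)|) +
    (|a ^ 2 * b| + |a * (5 * a ^ 3 + 32 * b ^ 2)| +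
      |2 * b * (13 * a ^ 3 + 96 * b ^ 2)| + |-3 * a ^ 2 * (a ^ 3 + 8 * b ^ 2)|) := ⟨_, rfl⟩
  have hC₁0 : 0 ≤ C₁ := by rw [hC₁]; positivity
  have hC₂0 : 0 ≤ C₂ := by rw [hC₂]; positivity
  refine ⟨C₁ + C₂ + 1, by lia, fun m n N D hmn hM hN hD ↦ ?_⟩
  have bez₁ : (0 * m ^ 3 + 12 * m ^ 2 * n + 0 * m * n ^ 2 + 16 * a * n ^ 3) * N +
      (-3 * m ^ 3 + 0 * m ^ 2 * n + 5 * a * m * n ^ 2 + 27 * b * n ^ 3) * D = k * n ^ 7 := by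
    rw [hN, hD, ← hk]; ring
  have bez₂ : (k * m ^ 3 + -4 * a ^ 2 * b * m ^ 2 * n +
      4 * a * (3 * a ^ 3 + 22 * b ^ 2) * m * n ^ 2 + 12 * b * (a ^ 3 + 8 * b ^ 2) * n ^ 3) * N +
      (a ^ 2 * b * m ^ 3 + a * (5 * a ^ 3 + 32 * b ^ 2) * m ^ 2 * n +
        2 * b * (13 * a ^ 3 + 96 * b ^ 2) * m * n ^ 2 +
        -3 * a ^ 2 * (a ^ 3 + 8 * b ^ 2) * n ^ 3) * D = k * m ^ 7 := by
    rw [hN, hD, ← hk]; ring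
  refine ⟨fun c ↦ dvd_of_dvd_bezout_of_isCoprime hmn bez₁ bez₂, ?_⟩
  have hm_le : |m| ≤ max |m| |n| := le_max_left _ _
  have hn_le : |n| ≤ max |m| |n| := le_max_right _ _
  have hmax : 0 ≤ max |N| |D| := le_max_of_le_left (abs_nonneg _)
  rcases max_choice |m| |n| with h | h
  · refine (abs_mul_pow_four_le_of_bezout hM h.symm
      (abs_cubic_form_le _ _ _ _ hm_le hn_le) (abs_cubic_form_le _ _ _ _ hm_le hn_le)
      bez₂).trans (mul_le_mul_of_nonneg_right ?_ hmax)
    rw [← hC₂]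
    lia
  · refine (abs_mul_pow_four_le_of_bezout hM h.symm
      (abs_cubic_form_le _ _ _ _ hm_le hn_le) (abs_cubic_form_le _ _ _ _ hm_le hn_le)
      bez₁).trans (mul_le_mul_of_nonneg_right ?_ hmax)
    rw [← hC₁]
    lia

/-- On `y² = x³ + ax + b`, duplication increases the height of points of large height. -/
theorem exists_naiveHeight_lt_duplication (a b : ℤ) (hΔ : 4 * a ^ 3 + 27 * b ^ 2 ≠ 0) :
    ∃ C : ℤ, ∀ x : ℚ, C < x.naiveHeight → x ^ 3 + a * x + b ≠ 0 ∧
      x.naiveHeight <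
        ((x ^ 4 - 2 * a * x ^ 2 - 8 * b * x + a ^ 2) / (4 * (x ^ 3 + a * x + b))).naiveHeight := by
  obtain ⟨C, hC, hbound⟩ := exists_duplication_bound a b
  have hk : 4 * (4 * a ^ 3 + 27 * b ^ 2) ≠ 0 := mul_ne_zero (by norm_num) hΔ
  generalize 4 * (4 * a ^ 3 + 27 * b ^ 2) = k at hbound hk
  refine ⟨C, fun x hx ↦ ?_⟩
  have hcop : IsCoprime x.num x.den := x.isCoprime_num_den
  have hn : (x.den : ℤ) ≠ 0 := by exact_mod_cast x.den_nz
  have hxmn : x = (x.num : ℚ) / (x.den : ℤ) := by exact_mod_cast (Rat.num_div_den x).symm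
  have hM : x.naiveHeight = max |x.num| |(x.den : ℤ)| := by rw [Rat.naiveHeight, Nat.abs_cast]
  generalize x.naiveHeight = M at hx hM
  generalize x.num = m at hcop hxmn hM
  generalize (x.den : ℤ) = n at hcop hxmn hM hn
  subst hxmn
  have hM0 : 0 < M := by lia
  obtain ⟨N, hN⟩ : ∃ N : ℤ,
    N = m ^ 4 - 2 * a * m ^ 2 * n ^ 2 - 8 * b * m * n ^ 3 + a ^ 2 * n ^ 4 := ⟨_, rfl⟩
  obtain ⟨D, hD⟩ : ∃ D : ℤ, D = 4 * n * (m ^ 3 + a * m * n ^ 2 + b * n ^ 3) := ⟨_, rfl⟩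
  obtain ⟨hdvd, hbound⟩ := hbound m n N D hcop (hM ▸ hM0) hN hD
  rw [← hM] at hbound
  have hkpos : 0 < |k| := abs_pos.mpr hk
  have hCM : C * M < M ^ 4 :=
    calc C * M < M * M := by gcongr
      _ = M ^ 2 := (sq M).symm
      _ ≤ M ^ 4 := pow_le_pow_right₀ hM0 (by norm_num)
  have hlarge {B : ℤ} (hB : max |N| |D| ≤ |k| * B) : M ^ 4 ≤ C * B := by
    refine le_of_mul_le_mul_left (hbound.trans ?_) hkpos
    calc C * max |N| |D| ≤ C * (|k| * B) := by gcongr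
      _ = |k| * (C * B) := by ring
  have hD0 : D ≠ 0 := by
    intro h0
    have hNk : |N| ≤ |k| := Int.le_of_dvd hkpos
      ((abs_dvd_abs _ _).mpr (hdvd N dvd_rfl (h0 ▸ dvd_zero N)))
    have hMC : M ^ 4 ≤ C * 1 :=
      hlarge (by rwa [h0, abs_zero, max_eq_left (abs_nonneg N), mul_one])
    have : C * 1 ≤ C * M := by gcongr; exact hM0
    lia
  have hnQ : (n : ℚ) ≠ 0 := by exact_mod_cast hn
  have hcubic := cubic_homogenization (a : ℚ) b m hnQ
  have hquartic := quartic_homogenization (a : ℚ) b m hnQ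
  have hDQ : (D : ℚ) = 4 * n * (m ^ 3 + a * m * n ^ 2 + b * n ^ 3) := by exact_mod_cast hD
  have hNQ : (N : ℚ) =
      m ^ 4 - 2 * a * m ^ 2 * n ^ 2 - 8 * b * m * n ^ 3 + a ^ 2 * n ^ 4 := by exact_mod_cast hN
  rw [← hDQ] at hcubic
  rw [← hNQ] at hquartic
  refine ⟨fun h0 ↦ hD0 ?_, ?_⟩
  · rw [h0, mul_zero] at hcubic
    exact_mod_cast hcubic
  · rw [← mul_div_mul_left _ _ (pow_ne_zero 4 hnQ), ← hquartic, ← mul_assoc,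
      mul_comm ((n : ℚ) ^ 4) 4, ← hcubic]
    have hle := Rat.max_abs_le_mul_naiveHeight_div hD0 hk hdvd
    by_contra! hlt
    have := hlarge (hle.trans (mul_le_mul_of_nonneg_left hlt hkpos.le))
    lia

theorem cubic_duplication {a b x f : ℚ} (hf : f ≠ 0) (h : f = x ^ 3 + a * x + b) :
    ((x ^ 4 - 2 * a * x ^ 2 - 8 * b * x + a ^ 2) / (4 * f)) ^ 3 +
      a * ((x ^ 4 - 2 * a * x ^ 2 - 8 * b * x + a ^ 2) / (4 * f)) + b =
    (x ^ 6 + 5 * a * x ^ 4 + 20 * b * x ^ 3 - 5 * a ^ 2 * x ^ 2 - 4 * a * b * x - 8 * b ^ 2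
      - a ^ 3) ^ 2 / (64 * f ^ 3) := by
  field_simp
  rw [h]
  ring

/-- All quadratic twists of `y² = x³ + ax + b` share a height bound beyond which
the existence of one rational point forces infinitely many. -/
theorem exists_infinite_of_naiveHeight_lt (a b : ℤ) (hΔ : 4 * a ^ 3 + 27 * b ^ 2 ≠ 0) :
    ∃ C : ℤ, ∀ c x y : ℚ, C < x.naiveHeight → y ^ 2 = c * (x ^ 3 + a * x + b) →
      {P : ℚ × ℚ | P.2 ^ 2 = c * (P.1 ^ 3 + a * P.1 + b)}.Infinite := by
  obtain ⟨C, hC⟩ := exists_naiveHeight_lt_duplication a b hΔ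
  refine ⟨C, fun c x y hx hxy hfin ↦ ?_⟩
  obtain ⟨⟨x₀, y₀⟩, ⟨h₀, hx₀⟩, hmax⟩ := Set.exists_max_image
    ({P : ℚ × ℚ | P.2 ^ 2 = c * (P.1 ^ 3 + a * P.1 + b)} ∩ {P | C < P.1.naiveHeight})
    (fun P ↦ P.1.naiveHeight) (hfin.inter_of_left _) ⟨(x, y), hxy, hx⟩
  simp only [Set.mem_ofPred_eq] at h₀ hx₀
  obtain ⟨hf, hlt⟩ := hC x₀ hx₀
  set x₁ := (x₀ ^ 4 - 2 * a * x₀ ^ 2 - 8 * b * x₀ + a ^ 2) / (4 * (x₀ ^ 3 + a * x₀ + b))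
  refine absurd (hmax (x₁, y₀ * (x₀ ^ 6 + 5 * a * x₀ ^ 4 + 20 * b * x₀ ^ 3 - 5 * a ^ 2 * x₀ ^ 2
    - 4 * a * b * x₀ - 8 * b ^ 2 - a ^ 3) / (8 * (x₀ ^ 3 + a * x₀ + b) ^ 2)) ⟨?_, hx₀.trans hlt⟩)
    (not_le.mpr hlt)
  rw [Set.mem_ofPred_eq, cubic_duplication hf rfl, div_pow, mul_pow, h₀]
  generalize x₀ ^ 3 + a * x₀ + b = f at hf
  field_simp
  ring

section BinaryQuartic

variable (a b c d e : ℚ)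

/-- The invariant `I` of a binary quartic form. -/
def quarticI : ℚ := 12 * a * e - 3 * b * d + c ^ 2

/-- The invariant `J` of a binary quartic form. -/
def quarticJ : ℚ :=
  72 * a * c * e + 9 * b * c * d - 27 * e * b ^ 2 - 27 * a * d ^ 2 - 2 * c ^ 3

/-- The dehomogenized quartic. -/
def quarticEval (t : ℚ) : ℚ := a * t ^ 4 + b * t ^ 3 + c * t ^ 2 + d * t + e

/-- The dehomogenized Hessian covariant of a binary quartic form. -/
def quarticHessian (t : ℚ) : ℚ :=
  (3 * b ^ 2 - 8 * a * c) * t ^ 4 + 4 * (b * c - 6 * a * d) * t ^ 3 +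
    2 * (2 * c ^ 2 - 24 * a * e - 3 * b * d) * t ^ 2 + 4 * (c * d - 6 * b * e) * t +
    (3 * d ^ 2 - 8 * c * e)

/-- The dehomogenized sextic covariant of a binary quartic form. -/
def quarticSextic (t : ℚ) : ℚ :=
  (b ^ 3 + 8 * a ^ 2 * d - 4 * a * b * c) * t ^ 6 +
    2 * (16 * a ^ 2 * e + 2 * a * b * d - 4 * a * c ^ 2 + b ^ 2 * c) * t ^ 5 +
    5 * (8 * a * b * e + b ^ 2 * d - 4 * a * c * d) * t ^ 4 +
    20 * (b ^ 2 * e - a * d ^ 2) * t ^ 3 -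
    5 * (8 * a * d * e + b * d ^ 2 - 4 * b * c * e) * t ^ 2 -
    2 * (16 * a * e ^ 2 + 2 * b * d * e - 4 * c ^ 2 * e + c * d ^ 2) * t -
    (d ^ 3 + 8 * b * e ^ 2 - 4 * c * d * e)

theorem quartic_syzygy (t : ℚ) :
    quarticHessian a b c d e t ^ 3 -
      48 * quarticI a b c d e * quarticEval a b c d e t ^ 2 * quarticHessian a b c d e t -
      64 * quarticJ a b c d e * quarticEval a b c d e t ^ 3 =
    27 * quarticSextic a b c d e t ^ 2 := by
  unfold quarticHessian quarticI quarticEval quarticJ quarticSextic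
  ring

variable {a b c d e}

theorem quartic_covering {t : ℚ} (ht : quarticEval a b c d e t ≠ 0) :
    (quarticHessian a b c d e t / (4 * quarticEval a b c d e t)) ^ 3 -
      3 * quarticI a b c d e * (quarticHessian a b c d e t / (4 * quarticEval a b c d e t)) -
      quarticJ a b c d e =
    27 * quarticSextic a b c d e t ^ 2 / (64 * quarticEval a b c d e t ^ 3) := by
  rw [← quartic_syzygy]
  field_simp
  ring

/-- A quartic proportional to its Hessian has zero discriminant. -/
theorem quartic_discr_eq_zero_of_hessian_eq_smul {l : ℚ}
    (h₀ : 3 * b ^ 2 - 8 * a * c = l * a) (h₁ : 4 * (b * c - 6 * a * d) = l * b)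
    (h₂ : 2 * (2 * c ^ 2 - 24 * a * e - 3 * b * d) = l * c)
    (h₃ : 4 * (c * d - 6 * b * e) = l * d) (h₄ : 3 * d ^ 2 - 8 * c * e = l * e) :
    4 * quarticI a b c d e ^ 3 - quarticJ a b c d e ^ 2 = 0 := by
  unfold quarticI quarticJ
  grind

open Polynomial in
theorem quartic_coeffs_eq_zero_of_infinite
    (h : {t : ℤ | quarticEval a b c d e t = 0}.Infinite) :
    a = 0 ∧ b = 0 ∧ c = 0 ∧ d = 0 ∧ e = 0 := by
  have hp : C a * X ^ 4 + C b * X ^ 3 + C c * X ^ 2 + C d * X + C e = 0 := by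
    refine eq_zero_of_infinite_isRoot _
      ((h.image (Int.cast_injective (α := ℚ)).injOn).mono ?_)
    rintro _ ⟨t, ht, rfl⟩
    simpa [quarticEval] using ht
  refine ⟨?_, ?_, ?_, ?_, ?_⟩
  · simpa [coeff_X, coeff_C] using congrArg (coeff · 4) hp
  · simpa [coeff_X, coeff_C] using congrArg (coeff · 3) hp
  · simpa [coeff_X, coeff_C] using congrArg (coeff · 2) hp
  · simpa [coeff_X, coeff_C] using congrArg (coeff · 1) hp
  · simpa [coeff_X, coeff_C] using congrArg (coeff · 0) hp

/-- The ratio of the Hessian of a nonsingular quartic to the quartic takes values of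
arbitrarily large height. -/
theorem exists_lt_naiveHeight_hessian_div
    (hdisc : 4 * quarticI a b c d e ^ 3 - quarticJ a b c d e ^ 2 ≠ 0) (C : ℤ) :
    ∃ t : ℤ, quarticEval a b c d e t ≠ 0 ∧
      C < (quarticHessian a b c d e t / (4 * quarticEval a b c d e t)).naiveHeight := by
  by_contra! hcon
  have hroots : {t : ℤ | quarticEval a b c d e t = 0}.Finite := by
    by_contra hinf
    obtain ⟨rfl, rfl, rfl, rfl, rfl⟩ := quartic_coeffs_eq_zero_of_infinite hinf
    norm_num [quarticI, quarticJ] at hdisc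
  have hfiber (l : ℚ) :
      {t : ℤ | quarticHessian a b c d e t = 4 * l * quarticEval a b c d e t}.Finite := by
    by_contra hinf
    obtain ⟨h₀, h₁, h₂, h₃, h₄⟩ := quartic_coeffs_eq_zero_of_infinite
      (a := 3 * b ^ 2 - 8 * a * c - 4 * l * a) (b := 4 * (b * c - 6 * a * d) - 4 * l * b)
      (c := 2 * (2 * c ^ 2 - 24 * a * e - 3 * b * d) - 4 * l * c)
      (d := 4 * (c * d - 6 * b * e) - 4 * l * d) (e := 3 * d ^ 2 - 8 * c * e - 4 * l * e)
      (Set.Infinite.mono (fun t ht ↦ by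
        simp only [Set.mem_ofPred_eq, quarticHessian, quarticEval] at ht ⊢
        linear_combination ht) hinf)
    exact hdisc (quartic_discr_eq_zero_of_hessian_eq_smul (sub_eq_zero.mp h₀)
      (sub_eq_zero.mp h₁) (sub_eq_zero.mp h₂) (sub_eq_zero.mp h₃) (sub_eq_zero.mp h₄))
  refine hroots.infinite_compl
    (((Rat.finite_naiveHeight_le C).biUnion fun l _ ↦ hfiber l).subset fun t ht ↦ ?_)
  have ht' : quarticEval a b c d e t ≠ 0 := ht
  refine Set.mem_biUnion (hcon t ht') ?_
  rw [Set.mem_ofPred_eq]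
  field_simp

end BinaryQuartic

theorem Int.exists_eq_squarefree_mul_sq {n : ℤ} (hn : n ≠ 0) :
    ∃ d w : ℤ, Squarefree d ∧ d ≠ 0 ∧ w ≠ 0 ∧ n = d * w ^ 2 := by
  obtain ⟨s, w, hsw, hs⟩ := Nat.sq_mul_squarefree n.natAbs
  have h : |n| = s * w ^ 2 := by rw [Int.abs_eq_natAbs, ← hsw]; push_cast; ring
  have hd : n = n.sign * s * w ^ 2 := by rw [mul_assoc, ← h, Int.sign_mul_abs]
  have hsq : Squarefree (n.sign * s) := by
    rw [← Int.squarefree_natAbs, Int.natAbs_mul, Int.natAbs_sign_of_ne_zero hn]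
    simpa using hs
  refine ⟨n.sign * s, w, hsq, hsq.ne_zero, ?_, hd⟩
  intro hw
  rw [hw] at hd
  exact hn (by simpa using hd)


/-- For a nonsingular integral binary quartic form
`F(x,y) = a4·x⁴ + a3·x³y + a2·x²y² + a1·xy³ + a0·y⁴` (nonsingularity is expressed by
the nonvanishing of the discriminant `(4·I(F)³ − J(F)²)/27`, i.e. `4·I(F)³ ≠ J(F)²`,
where `I(F) = 12·a4·a0 − 3·a3·a1 + a2²` and
`J(F) = 72·a4·a2·a0 + 9·a3·a2·a1 − 27·a0·a3² − 27·a4·a1² − 2·a2³`), there is a nonzero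
squarefree integer `d` such that the genus one curve `d·z² = F(u,v)` has a rational
point and its Jacobian `y² = x³ − (d²·I(F)/3)·x − (d³·J(F)/27)` has infinitely many
rational points (equivalently, positive Mordell–Weil rank). -/
theorem exists_squarefree_twist_with_point_and_positive_rank
    (a4 a3 a2 a1 a0 : ℤ)
    (hdisc : 4 * (12 * a4 * a0 - 3 * a3 * a1 + a2 ^ 2) ^ 3 -
        (72 * a4 * a2 * a0 + 9 * a3 * a2 * a1 - 27 * a0 * a3 ^ 2 - 27 * a4 * a1 ^ 2
          - 2 * a2 ^ 3) ^ 2 ≠ 0) :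
    ∃ d : ℤ, d ≠ 0 ∧ Squarefree d ∧
      (∃ u v z : ℚ, (u, v) ≠ (0, 0) ∧
        (d : ℚ) * z ^ 2 = a4 * u ^ 4 + a3 * u ^ 3 * v + a2 * u ^ 2 * v ^ 2 +
          a1 * u * v ^ 3 + a0 * v ^ 4) ∧
      {P : ℚ × ℚ | P.2 ^ 2 = P.1 ^ 3 -
          ((d : ℚ) ^ 2 * (12 * a4 * a0 - 3 * a3 * a1 + a2 ^ 2) / 3) * P.1 -
          ((d : ℚ) ^ 3 * (72 * a4 * a2 * a0 + 9 * a3 * a2 * a1 - 27 * a0 * a3 ^ 2 -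
            27 * a4 * a1 ^ 2 - 2 * a2 ^ 3) / 27)}.Infinite := by
  set I : ℤ := 12 * a4 * a0 - 3 * a3 * a1 + a2 ^ 2 with hI
  set J : ℤ := 72 * a4 * a2 * a0 + 9 * a3 * a2 * a1 - 27 * a0 * a3 ^ 2 - 27 * a4 * a1 ^ 2
    - 2 * a2 ^ 3 with hJ
  have hIQ : quarticI a4 a3 a2 a1 a0 = I := by rw [hI]; push_cast; rfl
  have hJQ : quarticJ a4 a3 a2 a1 a0 = J := by rw [hJ]; push_cast; rfl
  obtain ⟨C, hC⟩ := exists_infinite_of_naiveHeight_lt (-3 * I) (-J)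
    (fun h ↦ hdisc (by linarith))
  obtain ⟨t, ht, hht⟩ := exists_lt_naiveHeight_hessian_div
    (a := a4) (b := a3) (c := a2) (d := a1) (e := a0)
    (by rw [hIQ, hJQ]; exact_mod_cast hdisc) C
  have heval : quarticEval a4 a3 a2 a1 a0 t =
      (a4 * t ^ 4 + a3 * t ^ 3 + a2 * t ^ 2 + a1 * t + a0 : ℤ) := by
    push_cast; rfl
  obtain ⟨d, w, hd, hd0, hw0, hF⟩ := Int.exists_eq_squarefree_mul_sq
    (n := a4 * t ^ 4 + a3 * t ^ 3 + a2 * t ^ 2 + a1 * t + a0)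
    (fun h ↦ ht (by rw [heval, h, Int.cast_zero]))
  have hFQ : quarticEval a4 a3 a2 a1 a0 t = d * w ^ 2 := by
    rw [heval, hF]; push_cast; rfl
  have hdQ : (d : ℚ) ≠ 0 := by exact_mod_cast hd0
  have hwQ : (w : ℚ) ≠ 0 := by exact_mod_cast hw0
  refine ⟨d, hd0, hd, ⟨t, 1, w, by simp, by rw [← hFQ, quarticEval]; ring⟩, ?_⟩
  have hcov := quartic_covering ht
  rw [hIQ, hJQ] at hcov
  set ξ := quarticHessian a4 a3 a2 a1 a0 t / (4 * quarticEval a4 a3 a2 a1 a0 t)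
  have hcubic : ξ ^ 3 + (-3 * I : ℤ) * ξ + (-J : ℤ) =
      27 * quarticSextic a4 a3 a2 a1 a0 t ^ 2 / (64 * (d * w ^ 2) ^ 3) := by
    rw [← hFQ, ← hcov]; push_cast; ring
  have hinf := hC (d ^ 3 / 27) ξ (quarticSextic a4 a3 a2 a1 a0 t / (8 * w ^ 3)) hht
    (by rw [hcubic]; field_simp; norm_num)
  have hinj : Function.Injective fun P : ℚ × ℚ ↦ (d / 3 * P.1, P.2) := by
    rintro ⟨x, y⟩ ⟨x', y'⟩ h
    simpa [hdQ] using h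
  refine (hinf.image hinj.injOn).mono ?_
  rintro _ ⟨⟨x, y⟩, hP, rfl⟩
  rw [Set.mem_ofPred_eq] at hP ⊢
  rw [hP, hI, hJ]
  push_cast
  ring
end
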